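/- arXiv:1507.03293 — 4 statements merged into one kernel-verified Lean document; each statement's English description precedes it below -/
import Mathlib

section
/- Let a ∈ ℝ, β, η, ν > 0, and let h : ℝ → ℝ be bounded and measurable. Then the optimal value Z* of the worst-case tail problem with parameters (a, β, η, ν) equals the optimal value of OPT(𝒫⁺). Moreover, for every f feasible for the worst-case tail problem, the function p(x) = f′₊(x + a)/ν + 1 on [0, ∞) is the cumulative distribution function of a probability measure P on [0, ∞) that is feasible for OPT(𝒫⁺) and satisfies ν E_P[H(X)] = ∫_a^∞ h(x) f(x) dx; conversely, every P feasible for OPT(𝒫⁺) arises in this way from a unique feasible f, namely f(x) = η + ∫_a^x f′₊(t) dt with f′₊(x + a) = ν(p(x) − 1), where p is the distribution function of P. -/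
open MeasureTheory Set Filter Topology

/-- The right derivative of `f` at `x`: the derivative within `(x, ∞)`. -/
noncomputable def rightDeriv (f : ℝ → ℝ) (x : ℝ) : ℝ := derivWithin f (Set.Ioi x) x

/-- The right derivative of `f` exists at `x`. -/
def HasRightDerivAt (f : ℝ → ℝ) (x : ℝ) : Prop := ∃ d : ℝ, HasDerivWithinAt f d (Set.Ioi x) x

/-- `f` is feasible for the worst-case tail problem with parameters `(a, β, η, ν)`. -/
def Feasible (a β η ν : ℝ) (f : ℝ → ℝ) : Prop :=
  IntegrableOn f (Set.Ioi a) ∧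
  (∫ x in Set.Ioi a, f x) = β ∧
  f a = η ∧
  ContinuousWithinAt f (Set.Ici a) a ∧
  HasRightDerivAt f a ∧
  -ν ≤ rightDeriv f a ∧
  ConvexOn ℝ (Set.Ici a) f ∧
  (∀ x, a ≤ x → 0 ≤ f x)

/-- `H(x) = ∫₀ˣ ∫₀ᵘ h(v + a) dv du`. -/
noncomputable def Hfun (a : ℝ) (h : ℝ → ℝ) (x : ℝ) : ℝ :=
  ∫ u in (0:ℝ)..x, (∫ v in (0:ℝ)..u, h (v + a))

/-- `P` is a Borel probability measure on `[0, ∞)` (modelled as a measure on `ℝ`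
concentrated on `[0, ∞)`) with first moment `μ` and second moment `σ`. -/
def MomFeasible (μ σ : ℝ) (P : Measure ℝ) : Prop :=
  IsProbabilityMeasure P ∧ P (Set.Iio 0) = 0 ∧
  Integrable (fun x => x) P ∧ Integrable (fun x => x ^ 2) P ∧
  (∫ x, x ∂P) = μ ∧ (∫ x, x ^ 2 ∂P) = σ


lemma aux_max_integrable (x : ℝ) : IntegrableOn (fun y : ℝ => max (x - y) 0) (Ioi 0) := by
  have h1 : IntegrableOn (fun y : ℝ => max (x - y) 0) (Ioc 0 x) := by
    apply (Continuous.integrableOn_Icc (by fun_prop)).mono_set Ioc_subset_Icc_self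
  refine h1.of_forall_sdiff_eq_zero measurableSet_Ioi ?_
  rintro y ⟨hy, hy'⟩
  simp only [mem_Ioi, mem_Ioc, not_and, not_le] at hy hy'
  exact max_eq_right (by linarith [hy' hy])

lemma aux_H (a : ℝ) (h : ℝ → ℝ) (hmeas : Measurable h) (M : ℝ) (hM : ∀ x, |h x| ≤ M)
    (x : ℝ) (hx : 0 ≤ x) :
    ∫ y in Ioi (0:ℝ), h (y + a) * max (x - y) 0 = Hfun a h x := by
  have hk : Measurable (fun v => h (v + a)) := by fun_prop
  have hI : Integrable (Function.uncurry (fun u v : ℝ => (Iic u).indicator (fun v => h (v + a)) v))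
      ((volume.restrict (Ioc 0 x)).prod (volume.restrict (Ioc 0 x))) := by
    refine Integrable.of_bound (C := M) ?_ ?_
    · apply Measurable.aestronglyMeasurable
      have : Function.uncurry (fun u v : ℝ => (Iic u).indicator (fun v => h (v + a)) v)
          = {p : ℝ × ℝ | p.2 ≤ p.1}.indicator (fun p => h (p.2 + a)) := by
        ext p; simp [Function.uncurry, indicator]
      rw [this]
      exact Measurable.indicator (by fun_prop) (measurableSet_le measurable_snd measurable_fst)
    · refine Eventually.of_forall fun p => ?_
      simp only [Function.uncurry, indicator]
      split_ifs
      · exact hM _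
      · simpa using (abs_nonneg _).trans (hM 0)
  have hsw := integral_integral_swap hI
  unfold Hfun
  rw [intervalIntegral.integral_of_le hx]
  have e1 : ∫ u in Ioc 0 x, (∫ v in (0:ℝ)..u, h (v + a)) =
      ∫ u in Ioc 0 x, ∫ v in Ioc 0 x, (Iic u).indicator (fun v => h (v + a)) v := by
    refine setIntegral_congr_fun measurableSet_Ioc fun u hu => ?_
    rw [setIntegral_indicator measurableSet_Iic, intervalIntegral.integral_of_le hu.1.le]
    congr 2
    ext v; simp only [mem_Ioc, mem_inter_iff, mem_Iic]; constructor
    · rintro ⟨h1, h2⟩; exact ⟨⟨h1, h2.trans hu.2⟩, h2⟩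
    · rintro ⟨⟨h1, h2⟩, h3⟩; exact ⟨h1, h3⟩
  rw [e1, hsw]
  rw [setIntegral_eq_of_subset_of_forall_sdiff_eq_zero (t := Ioi 0) (s := Ioc 0 x)
    measurableSet_Ioi Ioc_subset_Ioi_self]
  · refine setIntegral_congr_fun measurableSet_Ioc fun v hv => ?_
    have : ∀ u, (Iic u).indicator (fun v => h (v + a)) v =
      (Ici v).indicator (fun _ => h (v + a)) u := by
      intro u; simp [indicator]
    simp_rw [this]
    rw [setIntegral_indicator measurableSet_Ici, setIntegral_const]
    have : Ioc 0 x ∩ Ici v = Icc v x := by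
      ext u; simp only [mem_Ioc, mem_inter_iff, mem_Ici, mem_Icc]; constructor
      · rintro ⟨⟨h1, h2⟩, h3⟩; exact ⟨h3, h2⟩
      · rintro ⟨h1, h2⟩; exact ⟨⟨hv.1.trans_le h1, h2⟩, h1⟩
    rw [this, Real.volume_real_Icc, smul_eq_mul, mul_comm]
  · rintro y ⟨hy, hy'⟩
    simp only [mem_Ioi, mem_Ioc, not_and, not_le] at hy hy'
    rw [max_eq_right (by linarith [hy' hy]), mul_zero]

lemma aux_sq (x : ℝ) (hx : 0 ≤ x) : ∫ y in Ioi (0:ℝ), max (x - y) 0 = x ^ 2 / 2 := by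
  have := aux_H 0 (fun _ => 1) measurable_const 1 (by simp) x hx
  simpa [Hfun] using this

lemma aux_ae {P : Measure ℝ} (h0 : P (Iio 0) = 0) : ∀ᵐ x ∂P, 0 ≤ x := by
  rw [ae_iff]; simpa [Iio] using h0

lemma aux_prodK {P : Measure ℝ} [IsProbabilityMeasure P] (h0 : P (Iio 0) = 0)
    (h2 : Integrable (fun x => x ^ 2) P) :
    Integrable (fun p : ℝ × ℝ => max (p.1 - p.2) 0) (P.prod (volume.restrict (Ioi 0))) := by
  rw [integrable_prod_iff (by fun_prop)]
  refine ⟨Eventually.of_forall fun x => aux_max_integrable x, ?_⟩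
  refine (h2.div_const 2).congr ?_
  filter_upwards [aux_ae h0] with x hx
  rw [← aux_sq x hx]
  simp [abs_of_nonneg]

lemma aux_sq_of_prodK {P : Measure ℝ} [IsProbabilityMeasure P] (h0 : P (Iio 0) = 0)
    (hK : Integrable (fun p : ℝ × ℝ => max (p.1 - p.2) 0) (P.prod (volume.restrict (Ioi 0)))) :
    Integrable (fun x => x ^ 2) P := by
  have := hK.integral_prod_left
  refine (this.const_mul 2).congr ?_
  filter_upwards [aux_ae h0] with x hx
  rw [aux_sq x hx]; ring

lemma aux_value {P : Measure ℝ} [IsProbabilityMeasure P] (h0 : P (Iio 0) = 0)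
    (hK : Integrable (fun p : ℝ × ℝ => max (p.1 - p.2) 0) (P.prod (volume.restrict (Ioi 0))))
    (a : ℝ) (h : ℝ → ℝ) (hmeas : Measurable h) (M : ℝ) (hM : ∀ x, |h x| ≤ M) :
    ∫ y in Ioi (0:ℝ), h (y + a) * ∫ x, max (x - y) 0 ∂P = ∫ x, Hfun a h x ∂P := by
  have hI : Integrable (Function.uncurry fun x y : ℝ => h (y + a) * max (x - y) 0)
      (P.prod (volume.restrict (Ioi 0))) := by
    refine Integrable.bdd_mul (c := M) hK ?_ ?_
    · exact Measurable.aestronglyMeasurable (by fun_prop)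
    · exact Eventually.of_forall fun p => hM _
  have := integral_integral_swap hI
  simp_rw [integral_const_mul] at this
  rw [← this]
  refine integral_congr_ae ?_
  filter_upwards [aux_ae h0] with x hx
  exact aux_H a h hmeas M hM x hx

lemma aux_value_sq {P : Measure ℝ} [IsProbabilityMeasure P] (h0 : P (Iio 0) = 0)
    (hK : Integrable (fun p : ℝ × ℝ => max (p.1 - p.2) 0) (P.prod (volume.restrict (Ioi 0)))) :
    ∫ y in Ioi (0:ℝ), ∫ x, max (x - y) 0 ∂P = (∫ x, x ^ 2 ∂P) / 2 := by
  have := aux_value h0 hK 0 (fun _ => 1) measurable_const 1 (by simp)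
  simpa [Hfun, integral_div] using this

/-- the tail function -/
lemma aux_meas {P : Measure ℝ} [IsProbabilityMeasure P] (t : ℝ) :
    (P (Ioi t)).toReal = 1 - (P (Iic t)).toReal := by
  have := prob_compl_eq_one_sub (μ := P) (measurableSet_Iic (a := t))
  rw [compl_Iic] at this
  rw [this, ENNReal.toReal_sub_of_le prob_le_one (by simp)]; simp

lemma aux_layer {P : Measure ℝ} [IsProbabilityMeasure P] (y : ℝ) :
    ∫⁻ x, ENNReal.ofReal (max (x - y) 0) ∂P = ∫⁻ t in Ioi y, P (Ioi t) := by
  have hnn : 0 ≤ᵐ[P] fun x => max (x - y) 0 := Eventually.of_forall fun x => le_max_right _ _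
  rw [lintegral_eq_lintegral_meas_lt P hnn
    (by fun_prop)]
  have := (measurePreserving_add_right volume y).setLIntegral_comp_preimage_emb
    (measurableEmbedding_addRight y) (fun t => P (Ioi t)) (Ioi y)
  rw [← this]
  have e : (fun x => x + y) ⁻¹' Ioi y = Ioi 0 := by ext; simp
  rw [e]
  refine setLIntegral_congr_fun measurableSet_Ioi fun t ht => ?_
  congr 1; ext x; simp only [mem_ofPred_eq, lt_max_iff, mem_Ioi] at ht ⊢
  constructor
  · rintro (h | h) <;> linarith
  · intro h; left; linarith

lemma aux_Gmeas {P : Measure ℝ} [IsProbabilityMeasure P] :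
    Measurable (fun t : ℝ => 1 - (P (Iic t)).toReal) := by
  have : Antitone (fun t : ℝ => 1 - (P (Iic t)).toReal) := by
    intro s t hst
    have : (P (Iic s)).toReal ≤ (P (Iic t)).toReal :=
      ENNReal.toReal_mono (measure_ne_top _ _) (measure_mono (Iic_subset_Iic.2 hst))
    simp only; linarith
  exact this.measurable

lemma aux_ofReal {P : Measure ℝ} [IsProbabilityMeasure P] (t : ℝ) :
    P (Ioi t) = ENNReal.ofReal (1 - (P (Iic t)).toReal) := by
  rw [← aux_meas, ENNReal.ofReal_toReal (measure_ne_top _ _)]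

lemma aux_Gnn {P : Measure ℝ} [IsProbabilityMeasure P] (t : ℝ) : 0 ≤ 1 - (P (Iic t)).toReal := by
  rw [← aux_meas]; positivity

lemma aux_tail {P : Measure ℝ} [IsProbabilityMeasure P] (y : ℝ) :
    ∫ x, max (x - y) 0 ∂P = ∫ t in Ioi y, (1 - (P (Iic t)).toReal) := by
  have hnn : 0 ≤ᵐ[P] fun x => max (x - y) 0 := Eventually.of_forall fun x => le_max_right _ _
  rw [integral_eq_lintegral_of_nonneg_ae hnn
    (by fun_prop), integral_eq_lintegral_of_nonneg_ae (Eventually.of_forall fun x => aux_Gnn x)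
    aux_Gmeas.aestronglyMeasurable, aux_layer]
  simp_rw [aux_ofReal]

lemma aux_tail_int {P : Measure ℝ} [IsProbabilityMeasure P] (y : ℝ) :
    Integrable (fun x => max (x - y) 0) P ↔
      IntegrableOn (fun t => 1 - (P (Iic t)).toReal) (Ioi y) := by
  unfold IntegrableOn Integrable
  have hnn : 0 ≤ᵐ[P] fun x => max (x - y) 0 := Eventually.of_forall fun x => le_max_right _ _
  rw [hasFiniteIntegral_iff_ofReal hnn,
    hasFiniteIntegral_iff_ofReal (Eventually.of_forall fun x => aux_Gnn x), aux_layer]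
  simp_rw [aux_ofReal]
  have h1 : AEStronglyMeasurable (fun x => max (x - y) 0) P := by fun_prop
  have h2 : AEStronglyMeasurable (fun t => 1 - (P (Iic t)).toReal) (volume.restrict (Ioi y)) :=
    aux_Gmeas.aestronglyMeasurable
  simp [h1, h2]


section cvx
variable {a : ℝ} {f : ℝ → ℝ}

lemma cvx_hasDeriv (hconv : ConvexOn ℝ (Ici a) f) (hd : HasRightDerivAt f a) {x : ℝ} (hx : a ≤ x) :
    HasDerivWithinAt f (rightDeriv f x) (Ioi x) x := by
  rcases hx.eq_or_lt with rfl | hx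
  · obtain ⟨d, hd⟩ := hd
    exact hd.differentiableWithinAt.hasDerivWithinAt
  · exact hconv.hasDerivWithinAt_rightDeriv_of_mem_interior (by simpa using hx)

lemma cvx_cont (hconv : ConvexOn ℝ (Ici a) f) (hc : ContinuousWithinAt f (Ici a) a) :
    ContinuousOn f (Ici a) := by
  intro x hx
  rcases (mem_Ici.1 hx).eq_or_lt with rfl | hx
  · exact hc
  · have h1 := hconv.continuousOn_interior
    rw [interior_Ici] at h1
    exact (h1.continuousAt (Ioi_mem_nhds hx)).continuousWithinAt

lemma cvx_le_slope (hconv : ConvexOn ℝ (Ici a) f) (hd : HasRightDerivAt f a) {x y : ℝ}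
    (hx : a ≤ x) (hxy : x < y) : rightDeriv f x ≤ slope f x y :=
  hconv.le_slope_of_hasDerivWithinAt_Ioi hx (hx.trans hxy.le) hxy (cvx_hasDeriv hconv hd hx)

lemma cvx_slope_le (hconv : ConvexOn ℝ (Ici a) f) {x y : ℝ}
    (hx : a ≤ x) (hxy : x < y) : slope f x y ≤ rightDeriv f y := by
  have hy : y ∈ interior (Ici a) := by simpa using hx.trans_lt hxy
  exact (hconv.slope_le_leftDeriv_of_mem_interior hx hy hxy).trans
    (hconv.leftDeriv_le_rightDeriv_of_mem_interior hy)

lemma cvx_mono (hconv : ConvexOn ℝ (Ici a) f) (hd : HasRightDerivAt f a) :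
    MonotoneOn (rightDeriv f) (Ici a) := by
  intro x hx y hy hxy
  rcases hxy.eq_or_lt with rfl | hxy
  · exact le_rfl
  · exact (cvx_le_slope hconv hd hx hxy).trans (cvx_slope_le hconv hx hxy)

lemma cvx_rc (hconv : ConvexOn ℝ (Ici a) f) (hc : ContinuousWithinAt f (Ici a) a)
    (hd : HasRightDerivAt f a) {x : ℝ} (hx : a ≤ x) :
    ContinuousWithinAt (rightDeriv f) (Ici x) x := by
  refine tendsto_order.2 ⟨fun b hb => ?_, fun c hcx => ?_⟩
  · filter_upwards [self_mem_nhdsWithin] with y hy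
    exact hb.trans_le (cvx_mono hconv hd hx (hx.trans hy) hy)
  · have h1 := (hasDerivWithinAt_iff_tendsto_slope' self_notMem_Ioi).mp (cvx_hasDeriv hconv hd hx)
    obtain ⟨z, hz, hxz⟩ := ((h1.eventually (gt_mem_nhds hcx)).and self_mem_nhdsWithin).exists
    have hxz : x < z := hxz
    have h2 : ContinuousWithinAt (fun y => slope f y z) (Ici x) x := by
      simp only [slope_def_field]
      have hfx : ContinuousWithinAt f (Ici x) x :=
        (cvx_cont hconv hc x hx).mono (Ici_subset_Ici.2 hx)
      refine ContinuousWithinAt.div (by fun_prop) (by fun_prop) (by linarith)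
    have h3 : ∀ᶠ y in 𝓝[Ici x] x, slope f y z < c := h2.eventually (gt_mem_nhds hz)
    have h4 : ∀ᶠ y in 𝓝[Ici x] x, y < z := nhdsWithin_le_nhds (gt_mem_nhds hxz)
    filter_upwards [h3, h4, self_mem_nhdsWithin] with y h3 h4 h5
    exact (cvx_le_slope hconv hd (hx.trans h5) h4).trans_lt h3

lemma cvx_nonpos (hconv : ConvexOn ℝ (Ici a) f) (hd : HasRightDerivAt f a)
    (hint : IntegrableOn f (Ioi a)) (hnn : ∀ x, a ≤ x → 0 ≤ f x) {x : ℝ} (hx : a ≤ x) :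
    rightDeriv f x ≤ 0 := by
  by_contra! hpos
  set z := x + 1 / rightDeriv f x with hz
  have hxz : x < z := by rw [hz]; have : 0 < 1 / rightDeriv f x := by positivity
                         linarith
  have hge : ∀ y ∈ Ioi z, 1 ≤ f y := by
    intro y hy
    have hxy : x < y := hxz.trans hy
    have h1 := cvx_le_slope hconv hd hx hxy
    rw [slope_def_field, le_div_iff₀ (by linarith)] at h1
    have h2 : rightDeriv f x * (z - x) = 1 := by rw [hz]; field_simp; ring
    have h3 : rightDeriv f x * (z - x) ≤ rightDeriv f x * (y - x) := by
      have : z < y := hy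
      gcongr
    linarith [hnn x hx]
  have h1 : IntegrableOn f (Ioi z) := hint.mono_set (Ioi_subset_Ioi (hx.trans hxz.le))
  have h2 : IntegrableOn (fun _ : ℝ => (1:ℝ)) (Ioi z) := by
    refine Integrable.mono' h1 (by fun_prop) ?_
    filter_upwards [ae_restrict_mem measurableSet_Ioi] with y hy
    simpa using hge y hy
  rw [integrableOn_const_iff] at h2
  simp at h2

lemma cvx_anti (hconv : ConvexOn ℝ (Ici a) f) (hd : HasRightDerivAt f a)
    (hint : IntegrableOn f (Ioi a)) (hnn : ∀ x, a ≤ x → 0 ≤ f x) :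
    AntitoneOn f (Ici a) := by
  intro x hx y hy hxy
  rcases hxy.eq_or_lt with rfl | hxy
  · exact le_rfl
  · have h1 := (cvx_slope_le hconv hx hxy).trans (cvx_nonpos hconv hd hint hnn hy)
    rw [slope_def_field, div_le_iff₀ (by linarith)] at h1
    linarith

lemma cvx_tendsto (hconv : ConvexOn ℝ (Ici a) f) (hd : HasRightDerivAt f a)
    (hint : IntegrableOn f (Ioi a)) (hnn : ∀ x, a ≤ x → 0 ≤ f x) :
    Tendsto f atTop (𝓝 0) := by
  have hb : ∀ y, a < y → f y ≤ (∫ x in Ioi a, f x) / (y - a) := by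
    intro y hy
    rw [le_div_iff₀ (by linarith)]
    have h1 : ∫ x in Ioc a y, f y ≤ ∫ x in Ioc a y, f x := by
      refine setIntegral_mono_on (by simp) (hint.mono_set Ioc_subset_Ioi_self)
        measurableSet_Ioc fun x hx => ?_
      exact cvx_anti hconv hd hint hnn hx.1.le hy.le hx.2
    have h2 : ∫ x in Ioc a y, f x ≤ ∫ x in Ioi a, f x := by
      refine setIntegral_mono_set hint ?_ (Ioc_subset_Ioi_self.eventuallyLE)
      filter_upwards [ae_restrict_mem measurableSet_Ioi] with x hx
      exact hnn x (le_of_lt hx)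
    rw [setIntegral_const, Real.volume_real_Ioc_of_le hy.le, smul_eq_mul] at h1
    linarith
  refine tendsto_of_tendsto_of_tendsto_of_le_of_le' tendsto_const_nhds
    (h := fun y => (∫ x in Ioi a, f x) / (y - a)) ?_ ?_ ?_
  · exact Tendsto.div_atTop tendsto_const_nhds (tendsto_atTop_add_const_right _ _ tendsto_id)
  · filter_upwards [eventually_ge_atTop a] with x hx using hnn x hx
  · filter_upwards [eventually_gt_atTop a] with x hx using hb x hx

lemma cvx_tendsto_deriv (hconv : ConvexOn ℝ (Ici a) f) (hd : HasRightDerivAt f a)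
    (hint : IntegrableOn f (Ioi a)) (hnn : ∀ x, a ≤ x → 0 ≤ f x) :
    Tendsto (rightDeriv f) atTop (𝓝 0) := by
  have h1 : Tendsto (fun y => - f (y - 1)) atTop (𝓝 0) := by
    have := ((cvx_tendsto hconv hd hint hnn).comp
      (tendsto_atTop_add_const_right atTop (-1) tendsto_id)).neg
    simpa [Function.comp_def, sub_eq_add_neg] using this
  refine tendsto_of_tendsto_of_tendsto_of_le_of_le' h1 tendsto_const_nhds ?_ ?_
  · filter_upwards [eventually_ge_atTop (a + 1)] with y hy
    have h2 := cvx_slope_le hconv (x := y - 1) (y := y) (by linarith) (by linarith)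
    rw [slope_def_field] at h2
    have := hnn y (by linarith)
    simp only [sub_sub_cancel, div_one] at h2
    linarith
  · filter_upwards [eventually_ge_atTop a] with x hx using cvx_nonpos hconv hd hint hnn hx

lemma cvx_ftc (hconv : ConvexOn ℝ (Ici a) f) (hc : ContinuousWithinAt f (Ici a) a)
    (hd : HasRightDerivAt f a) {y z : ℝ} (hy : a ≤ y) (hyz : y ≤ z) :
    ∫ t in y..z, rightDeriv f t = f z - f y := by
  refine intervalIntegral.integral_eq_sub_of_hasDeriv_right_of_le hyz
    ((cvx_cont hconv hc).mono (Icc_subset_Ici_self.trans (Ici_subset_Ici.2 hy)))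
    (fun x hx => cvx_hasDeriv hconv hd (hy.trans hx.1.le)) ?_
  apply MonotoneOn.intervalIntegrable
  apply (cvx_mono hconv hd).mono
  rw [uIcc_of_le hyz]
  exact Icc_subset_Ici_self.trans (Ici_subset_Ici.2 hy)

lemma cvx_improper (hconv : ConvexOn ℝ (Ici a) f) (hc : ContinuousWithinAt f (Ici a) a)
    (hd : HasRightDerivAt f a)
    (hint : IntegrableOn f (Ioi a)) (hnn : ∀ x, a ≤ x → 0 ≤ f x) {y : ℝ} (hy : a ≤ y) :
    IntegrableOn (rightDeriv f) (Ioi y) ∧ ∫ t in Ioi y, rightDeriv f t = - f y := by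
  have hl : Tendsto (fun z => ∫ t in y..z, rightDeriv f t) atTop (𝓝 (0 - f y)) := by
    refine ((cvx_tendsto hconv hd hint hnn).sub_const (f y)).congr' ?_
    filter_upwards [eventually_ge_atTop y] with z hz
    rw [cvx_ftc hconv hc hd hy hz]
  have hI : IntegrableOn (rightDeriv f) (Ioi y) := by
    refine integrableOn_Ioi_of_intervalIntegral_norm_tendsto (-(0 - f y)) y (l := atTop)
      (b := fun z => z) (fun z => ?_) tendsto_id ?_
    · have : IntegrableOn (rightDeriv f) (Icc y z) := by
        apply MonotoneOn.integrableOn_isCompact isCompact_Icc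
        apply (cvx_mono hconv hd).mono
        exact Icc_subset_Ici_self.trans (Ici_subset_Ici.2 hy)
      exact this.mono_set Ioc_subset_Icc_self
    · refine hl.neg.congr' ?_
      filter_upwards [eventually_ge_atTop y] with z hz
      rw [← intervalIntegral.integral_neg]
      refine intervalIntegral.integral_congr fun t ht => ?_
      rw [uIcc_of_le hz] at ht
      simp only [Real.norm_eq_abs]
      rw [abs_of_nonpos (cvx_nonpos hconv hd hint hnn (hy.trans ht.1))]
  refine ⟨hI, ?_⟩
  have := tendsto_nhds_unique (intervalIntegral_tendsto_integral_Ioi y hI tendsto_id) hl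
  rw [this]; ring

end cvx

lemma aux_shift (g : ℝ → ℝ) (a y : ℝ) : ∫ t in Ioi (y + a), g t = ∫ t in Ioi y, g (t + a) := by
  have := (measurePreserving_add_right volume a).setIntegral_preimage_emb
    (measurableEmbedding_addRight a) g (Ioi (y + a))
  rw [← this]; simp

lemma aux_shift_int (g : ℝ → ℝ) (a y : ℝ) :
    IntegrableOn g (Ioi (y + a)) ↔ IntegrableOn (fun t => g (t + a)) (Ioi y) := by
  have := (measurePreserving_add_right volume a).integrableOn_comp_preimage
    (measurableEmbedding_addRight a) (f := g) (s := Ioi (y + a))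
  rw [← this]; simp [Function.comp_def]

lemma value_of_rep {P : Measure ℝ} [IsProbabilityMeasure P] (h0 : P (Iio 0) = 0)
    (h2 : Integrable (fun x => x ^ 2) P) (a ν : ℝ) (f : ℝ → ℝ)
    (hf : ∀ y, 0 ≤ y → f (y + a) = ν * ∫ x, max (x - y) 0 ∂P)
    (h : ℝ → ℝ) (hmeas : Measurable h) (M : ℝ) (hM : ∀ x, |h x| ≤ M) :
    ν * ∫ x, Hfun a h x ∂P = ∫ x in Ioi a, h x * f x := by
  have e := aux_shift (fun x => h x * f x) a 0
  rw [zero_add] at e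
  rw [e, ← aux_value h0 (aux_prodK h0 h2) a h hmeas M hM, ← integral_const_mul]
  refine setIntegral_congr_fun measurableSet_Ioi fun y hy => ?_
  rw [hf y (le_of_lt hy)]; ring

lemma forward {a β η ν : ℝ} (hν : 0 < ν) {f : ℝ → ℝ} (hF : Feasible a β η ν f) :
    ∃ P : Measure ℝ, MomFeasible (η / ν) (2 * β / ν) P ∧
        (∀ x, 0 ≤ x → (P (Set.Iic x)).toReal = rightDeriv f (x + a) / ν + 1) ∧
        (∀ y, 0 ≤ y → f (y + a) = ν * ∫ x, max (x - y) 0 ∂P) := by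
  obtain ⟨hint, hβ, hη, hc, hd, hdν, hconv, hnn⟩ := hF
  have hFnn : ∀ x, 0 ≤ x → 0 ≤ rightDeriv f (x + a) / ν + 1 := by
    intro x hx
    have h1 := cvx_mono hconv hd (mem_Ici.2 le_rfl) (mem_Ici.2 (by linarith : a ≤ x + a))
      (by linarith)
    have : -1 ≤ rightDeriv f (x + a) / ν := by
      rw [le_div_iff₀ hν]; linarith
    linarith
  let F : StieltjesFunction ℝ :=
    { toFun := fun x => if x < 0 then 0 else rightDeriv f (x + a) / ν + 1
      mono' := by
        intro x y hxy
        simp only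
        split_ifs with h1 h2 h2
        · exact le_rfl
        · exact hFnn y (not_lt.1 h2)
        · exact absurd (hxy.trans_lt h2) h1
        · have := cvx_mono hconv hd (mem_Ici.2 (by linarith : a ≤ x + a))
            (mem_Ici.2 (by linarith : a ≤ y + a)) (by linarith)
          gcongr
      right_continuous' := by
        intro x
        by_cases hx : x < 0
        · refine ContinuousAt.continuousWithinAt ?_
          refine (continuousAt_const (y := (0:ℝ))).congr ?_
          filter_upwards [gt_mem_nhds hx] with y hy
          simp [hy]
        · have h1 := cvx_rc hconv hc hd (x := x + a) (by linarith)
          have h2 : ContinuousWithinAt (fun x => rightDeriv f (x + a)) (Ici x) x := by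
            refine ContinuousWithinAt.comp (t := Ici (x + a)) (f := fun x => x + a) h1
              (by fun_prop) ?_
            intro y hy; simpa using hy
          refine ((h2.div_const ν).add (continuousWithinAt_const (b := (1:ℝ)))).congr ?_ ?_
          · intro y hy; rw [if_neg (not_lt.2 ((not_lt.1 hx).trans hy))]; rfl
          · rw [if_neg hx]; rfl }
  have hFdef : ∀ x, F x = if x < 0 then 0 else rightDeriv f (x + a) / ν + 1 := fun x => rfl
  have hbot : Tendsto F atBot (𝓝 0) := by
    refine tendsto_const_nhds.congr' ?_
    filter_upwards [eventually_lt_atBot 0] with x hx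
    rw [hFdef, if_pos hx]
  have htop : Tendsto F atTop (𝓝 1) := by
    have h1 := ((cvx_tendsto_deriv hconv hd hint hnn).comp
      (tendsto_atTop_add_const_right atTop a tendsto_id)).div_const ν |>.add_const 1
    simp only [zero_div, zero_add] at h1
    refine h1.congr' ?_
    filter_upwards [eventually_ge_atTop 0] with x hx
    rw [hFdef, if_neg (not_lt.2 hx)]; rfl
  have hP : IsProbabilityMeasure F.measure := F.isProbabilityMeasure hbot htop
  have h0 : F.measure (Iio 0) = 0 := by
    rw [F.measure_Iio hbot]
    have : Function.leftLim F 0 = 0 := by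
      apply leftLim_eq_of_tendsto
      refine tendsto_const_nhds.congr' ?_
      filter_upwards [self_mem_nhdsWithin] with x hx
      rw [hFdef, if_pos (mem_Iio.1 hx)]
    simp [this]
  have hcdf : ∀ x, 0 ≤ x → (F.measure (Iic x)).toReal = rightDeriv f (x + a) / ν + 1 := by
    intro x hx
    rw [F.measure_Iic hbot, hFdef, if_neg (not_lt.2 hx), sub_zero,
      ENNReal.toReal_ofReal (hFnn x hx)]
  have hG : ∀ y, 0 ≤ y → IntegrableOn (fun t => 1 - (F.measure (Iic t)).toReal) (Ioi y) ∧
      f (y + a) = ν * ∫ t in Ioi y, (1 - (F.measure (Iic t)).toReal) := by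
    intro y hy
    have heq : EqOn (fun t => -(rightDeriv f (t + a)) / ν)
        (fun t => 1 - (F.measure (Iic t)).toReal) (Ioi y) := by
      intro t ht
      simp only
      rw [hcdf t (hy.trans (le_of_lt ht))]; ring
    obtain ⟨i1, i2⟩ := cvx_improper hconv hc hd hint hnn (y := y + a) (by linarith)
    rw [aux_shift_int] at i1
    rw [aux_shift] at i2
    refine ⟨IntegrableOn.congr_fun (i1.neg.div_const ν) heq measurableSet_Ioi, ?_⟩
    rw [← setIntegral_congr_fun measurableSet_Ioi heq, integral_div, integral_neg, i2]
    field_simp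
  have hrep : ∀ y, 0 ≤ y → f (y + a) = ν * ∫ x, max (x - y) 0 ∂F.measure := by
    intro y hy
    rw [aux_tail]; exact (hG y hy).2
  have hInt : ∀ y, 0 ≤ y → Integrable (fun x => max (x - y) 0) F.measure := fun y hy =>
    (aux_tail_int y).2 (hG y hy).1
  have hmax : (fun x => max (x - 0) 0) =ᵐ[F.measure] fun x => x := by
    filter_upwards [aux_ae h0] with x hx
    simp [hx]
  have hsh := aux_shift f a 0
  have hshi := aux_shift_int f a 0
  rw [zero_add] at hsh hshi
  have hK : Integrable (fun p : ℝ × ℝ => max (p.1 - p.2) 0)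
      (F.measure.prod (volume.restrict (Ioi 0))) := by
    rw [integrable_prod_iff' (by fun_prop)]
    constructor
    · filter_upwards [ae_restrict_mem measurableSet_Ioi] with y hy using hInt y (le_of_lt hy)
    · have h1 : IntegrableOn (fun t => f (t + a) / ν) (Ioi 0) := (hshi.1 hint).div_const ν
      refine h1.congr_fun (fun y hy => ?_) measurableSet_Ioi
      simp only [Real.norm_eq_abs, abs_of_nonneg (le_max_right _ (0:ℝ))]
      rw [hrep y (le_of_lt hy)]
      field_simp
  have hsq := aux_value_sq h0 hK
  refine ⟨F.measure, ⟨hP, h0, (hInt 0 le_rfl).congr hmax, aux_sq_of_prodK h0 hK, ?_, ?_⟩,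
    hcdf, hrep⟩
  · rw [← integral_congr_ae hmax, eq_div_iff hν.ne', mul_comm, ← hrep 0 le_rfl, zero_add, hη]
  · have : ∫ y in Ioi 0, f (y + a) = ν * ((∫ x, x ^ 2 ∂F.measure) / 2) := by
      rw [← hsq, ← integral_const_mul]
      exact setIntegral_congr_fun measurableSet_Ioi fun y hy => hrep y (le_of_lt hy)
    rw [← hsh, hβ] at this
    rw [this]; field_simp

lemma backward {a β η ν : ℝ} (hν : 0 < ν) {P : Measure ℝ}
    (hP : MomFeasible (η / ν) (2 * β / ν) P) :
    ∃ f : ℝ → ℝ, Feasible a β η ν f ∧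
      (∀ y, 0 ≤ y → f (y + a) = ν * ∫ x, max (x - y) 0 ∂P) ∧
      (∀ x, 0 ≤ x → rightDeriv f (x + a) = ν * ((P (Set.Iic x)).toReal - 1)) ∧
      (∀ x, a ≤ x → f x = η + ∫ t in a..x, rightDeriv f t) := by
  obtain ⟨hprob, h0, hX, hX2, hμ, hσ⟩ := hP
  have hmi : ∀ y, Integrable (fun x => max (x - y) 0) P := fun y =>
    (hX.sub (integrable_const y)).sup (integrable_zero _ _ _)
  let f : ℝ → ℝ := fun x => ν * ∫ s, max (s - (x - a)) 0 ∂P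
  have hfdef : ∀ x, f x = ν * ∫ s, max (s - (x - a)) 0 ∂P := fun x => rfl
  have hrep : ∀ y, 0 ≤ y → f (y + a) = ν * ∫ x, max (x - y) 0 ∂P := by
    intro y _; rw [hfdef, add_sub_cancel_right]
  have hfa : f a = η := by
    have hmax : (fun x => max (x - 0) 0) =ᵐ[P] fun x => x := by
      filter_upwards [aux_ae h0] with x hx
      simp [hx]
    rw [hfdef, sub_self, integral_congr_ae hmax, hμ]; field_simp
  have hnn : ∀ x, 0 ≤ f x := fun x => mul_nonneg hν.le (integral_nonneg fun s => le_max_right _ _)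
  have hconv : ConvexOn ℝ (Ici a) f := by
    refine ⟨convex_Ici a, fun x _ y _ p q hp hq hpq => ?_⟩
    simp only [smul_eq_mul]
    rw [hfdef, hfdef, hfdef]
    have key : ∫ s, max (s - (p * x + q * y - a)) 0 ∂P ≤
        ∫ s, (p * max (s - (x - a)) 0 + q * max (s - (y - a)) 0) ∂P := by
      refine integral_mono (hmi _) (((hmi _).const_mul p).add ((hmi _).const_mul q)) fun s => ?_
      simp only
      apply max_le
      · have e : s - (p * x + q * y - a) = p * (s - (x - a)) + q * (s - (y - a)) := by
          have : q = 1 - p := by linarith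
          subst this; ring
        rw [e]
        have := le_max_left (s - (x - a)) 0
        have := le_max_left (s - (y - a)) 0
        gcongr
      · have := le_max_right (s - (x - a)) 0
        have := le_max_right (s - (y - a)) 0
        positivity
    rw [integral_add ((hmi _).const_mul p) ((hmi _).const_mul q), integral_const_mul,
      integral_const_mul] at key
    nlinarith [mul_le_mul_of_nonneg_left key hν.le]
  have hGi : ∀ y, IntegrableOn (fun t => 1 - (P (Iic t)).toReal) (Ioi y) :=
    fun y => (aux_tail_int y).1 (hmi y)
  have hGii : ∀ y z, IntervalIntegrable (fun t => 1 - (P (Iic t)).toReal) volume y z :=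
    fun y z => ⟨(hGi y).mono_set Ioc_subset_Ioi_self, (hGi z).mono_set Ioc_subset_Ioi_self⟩
  have hcdfeq : ∀ t, (P (Iic t)).toReal = ProbabilityTheory.cdf P t := fun t =>
    (ProbabilityTheory.cdf_eq_real P t).symm
  have hrc : ∀ t, ContinuousWithinAt (fun t => 1 - (P (Iic t)).toReal) (Ioi t) t := by
    intro t
    simp_rw [hcdfeq]
    exact continuousWithinAt_const.sub
      (((ProbabilityTheory.cdf P).right_continuous t).mono Ioi_subset_Ici_self)
  have hfint : ∀ x, f x = f a - ν * ∫ t in (0:ℝ)..(x - a), (1 - (P (Iic t)).toReal) := by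
    intro x
    rw [hfdef, hfdef, aux_tail, aux_tail, sub_self,
      ← intervalIntegral.integral_Ioi_sub_Ioi' (hGi 0) (hGi (x - a))]
    ring
  have hder : ∀ x, HasDerivWithinAt f (ν * ((P (Iic (x - a))).toReal - 1)) (Ioi x) x := by
    intro x
    have h1 : HasDerivWithinAt (fun u => ∫ t in (0:ℝ)..u, (1 - (P (Iic t)).toReal))
        (1 - (P (Iic (x - a))).toReal) (Ioi (x - a)) (x - a) :=
      (intervalIntegral.integral_hasDerivWithinAt_right (hGii _ _) (s := Ici (x - a))
        (t := Ioi (x - a)) (aux_Gmeas.stronglyMeasurable.stronglyMeasurableAtFilter)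
        (hrc _)).mono Ioi_subset_Ici_self
    have h2 : HasDerivWithinAt (fun x : ℝ => x - a) 1 (Ioi x) x :=
      (hasDerivWithinAt_id _ _).sub_const a
    have h3 := (h1.comp x h2 (fun y hy => by simpa using hy)).const_mul ν |>.const_sub (f a)
    refine (h3.congr (fun y _ => ?_) ?_).congr_deriv ?_
    · exact hfint y
    · exact hfint x
    · ring
  have hrd : ∀ x, rightDeriv f x = ν * ((P (Iic (x - a))).toReal - 1) := fun x =>
    (hder x).derivWithin (uniqueDiffWithinAt_Ioi x)
  have hK := aux_prodK h0 hX2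
  have hsh := aux_shift f a 0
  have hshi := aux_shift_int f a 0
  rw [zero_add] at hsh hshi
  refine ⟨f, ⟨?_, ?_, hfa, ?_, ⟨_, hder a⟩, ?_, hconv, fun x _ => hnn x⟩, hrep, ?_, ?_⟩
  · rw [hshi]
    have := hK.integral_prod_right.const_mul ν
    refine IntegrableOn.congr_fun this (fun y hy => ?_) measurableSet_Ioi
    rw [hrep y (le_of_lt hy)]
  · rw [hsh, setIntegral_congr_fun measurableSet_Ioi fun y hy => hrep y (le_of_lt hy),
      integral_const_mul, aux_value_sq h0 hK, hσ]
    field_simp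
  · exact continuousWithinAt_Ioi_iff_Ici.1 (hder a).continuousWithinAt
  · rw [hrd]
    have : 0 ≤ (P (Iic (a - a))).toReal := ENNReal.toReal_nonneg
    nlinarith
  · intro x _; rw [hrd, add_sub_cancel_right]
  · intro x _
    rw [hfint, hfa, intervalIntegral.integral_congr (fun t _ => hrd t),
      intervalIntegral.integral_comp_sub_right (fun t => ν * ((P (Iic t)).toReal - 1)) a, sub_self,
      intervalIntegral.integral_const_mul, sub_eq_add_neg, ← mul_neg,
      ← intervalIntegral.integral_neg]
    simp

/-- Theorem 2: the worst-case tail problem has the same optimal value as the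
moment-constrained problem `OPT(𝒫⁺)`, with a one-to-one correspondence between
feasible solutions given via the cdf `p(x) = f′₊(x + a)/ν + 1`. -/
theorem worstcase_eq_moment_problem
    (a β η ν : ℝ) (hβ : 0 < β) (hη : 0 < η) (hν : 0 < ν)
    (h : ℝ → ℝ) (hmeas : Measurable h) (hbd : ∃ M, ∀ x, |h x| ≤ M) :
    (sSup {z : ℝ | ∃ f : ℝ → ℝ, Feasible a β η ν f ∧ z = ∫ x in Set.Ioi a, h x * f x} =
      sSup {z : ℝ | ∃ P : Measure ℝ, MomFeasible (η / ν) (2 * β / ν) P ∧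
        z = ν * ∫ x, Hfun a h x ∂P}) ∧
    (∀ f : ℝ → ℝ, Feasible a β η ν f →
      ∃ P : Measure ℝ, MomFeasible (η / ν) (2 * β / ν) P ∧
        (∀ x, 0 ≤ x → (P (Set.Iic x)).toReal = rightDeriv f (x + a) / ν + 1) ∧
        ν * ∫ x, Hfun a h x ∂P = ∫ x in Set.Ioi a, h x * f x) ∧
    (∀ P : Measure ℝ, MomFeasible (η / ν) (2 * β / ν) P →
      ∃ f : ℝ → ℝ, (Feasible a β η ν f ∧
          (∀ x, 0 ≤ x → rightDeriv f (x + a) = ν * ((P (Set.Iic x)).toReal - 1)) ∧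
          (∀ x, a ≤ x → f x = η + ∫ t in a..x, rightDeriv f t)) ∧
        (∀ g : ℝ → ℝ, (Feasible a β η ν g ∧
            (∀ x, 0 ≤ x → rightDeriv g (x + a) = ν * ((P (Set.Iic x)).toReal - 1)) ∧
            (∀ x, a ≤ x → g x = η + ∫ t in a..x, rightDeriv g t)) →
          ∀ x, a ≤ x → g x = f x)) := by

  obtain ⟨M, hM⟩ := hbd
  refine ⟨?_, ?_, ?_⟩
  · congr 1
    ext z
    constructor
    · rintro ⟨f, hf, rfl⟩
      obtain ⟨P, hP, -, hrep⟩ := forward hν hf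
      have := hP.1
      exact ⟨P, hP, (value_of_rep hP.2.1 hP.2.2.2.1 a ν f hrep h hmeas M hM).symm⟩
    · rintro ⟨P, hP, rfl⟩
      obtain ⟨f, hf, hrep, -⟩ := backward (a := a) hν hP
      have := hP.1
      exact ⟨f, hf, value_of_rep hP.2.1 hP.2.2.2.1 a ν f hrep h hmeas M hM⟩
  · intro f hf
    obtain ⟨P, hP, hcdf, hrep⟩ := forward hν hf
    have := hP.1
    exact ⟨P, hP, hcdf, value_of_rep hP.2.1 hP.2.2.2.1 a ν f hrep h hmeas M hM⟩
  · intro P hP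
    obtain ⟨f, hf, hrep, hrd, hint⟩ := backward (a := a) hν hP
    refine ⟨f, ⟨hf, hrd, hint⟩, ?_⟩
    rintro g ⟨-, hgrd, hgint⟩ x hx
    rw [hgint x hx, hint x hx]
    congr 1
    refine intervalIntegral.integral_congr fun t ht => ?_
    rw [uIcc_of_le hx] at ht
    have h1 := hgrd (t - a) (by linarith [ht.1])
    have h2 := hrd (t - a) (by linarith [ht.1])
    rw [sub_add_cancel] at h1 h2
    rw [h1, h2]
end

section
/- Let a ∈ ℝ, β, η, ν > 0, and let h : ℝ → ℝ be bounded and measurable. Suppose H is convex on [0, ∞) and its derivative H′ is convex on (0, c) and concave on (c, ∞) for some 0 ≤ c ≤ ∞. Then the optimal value of OPT(𝒫⁺) equals the optimal value of OPT(𝒫₂⁺); that is, the supremum of ν E_P[H(X)] over Borel probability measures P on [0, ∞) with E_P[X] = μ and E_P[X²] = σ equals the supremum of the same quantity over such measures supported on at most 2 points. -/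
open MeasureTheory Set Filter Topology

/-- The measure `P` is supported on at most `n` points. -/
def SuppAtMost (n : ℕ) (P : Measure ℝ) : Prop :=
  ∃ s : Finset ℝ, s.card ≤ n ∧ P ((s : Set ℝ)ᶜ) = 0


lemma noPattern (k : ℝ → ℝ) (c : ℝ) (hc : 0 ≤ c) (hconv : ConvexOn ℝ (Icc 0 c) k)
    (hconc : ConcaveOn ℝ (Ici c) k) (u0 u1 u2 u3 : ℝ) (h0 : 0 ≤ u0) (h01 : u0 < u1)
    (h12 : u1 < u2) (h23 : u2 < u3) (a : k u0 < k u1) (b : k u2 < k u1) (d : k u2 < k u3) :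
    False := by
  rcases le_or_gt u2 c with h | h
  · have := hconv.le_max_of_mem_Icc (x := u0) (y := u2) (z := u1) ⟨h0, by linarith⟩
      ⟨by linarith, h⟩ ⟨h01.le, h12.le⟩
    rcases le_max_iff.1 this with h | h <;> linarith
  rcases le_or_gt c u1 with hu | hu
  · have := hconc.min_le_of_mem_Icc (x := u1) (y := u3) (z := u2) hu
      (by simp only [mem_Ici]; linarith) ⟨h12.le, h23.le⟩
    rcases min_le_iff.1 this with h | h <;> linarith
  have h1 := hconv.le_max_of_mem_Icc (x := u0) (y := c) (z := u1) ⟨h0, by linarith⟩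
      ⟨by linarith, le_rfl⟩ ⟨h01.le, hu.le⟩
  have h2 := hconc.min_le_of_mem_Icc (x := c) (y := u3) (z := u2) (by simp)
      (by simp only [mem_Ici]; linarith) ⟨h.le, h23.le⟩
  rcases le_max_iff.1 h1 with h | h <;> rcases min_le_iff.1 h2 with h | h <;> linarith

lemma exPos (f k : ℝ → ℝ) (hf : ∀ x, HasDerivAt f (k x) x) (p q : ℝ) (hpq : p < q)
    (h : f p < f q) : ∃ r, p < r ∧ r < q ∧ 0 < k r := by
  obtain ⟨r, hr, e⟩ := exists_hasDerivAt_eq_slope f k hpq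
    (fun x _ => (hf x).continuousAt.continuousWithinAt) (fun x _ => hf x)
  exact ⟨r, hr.1, hr.2, by rw [e]; apply div_pos <;> linarith⟩

lemma exNeg (f k : ℝ → ℝ) (hf : ∀ x, HasDerivAt f (k x) x) (p q : ℝ) (hpq : p < q)
    (h : f q < f p) : ∃ r, p < r ∧ r < q ∧ k r < 0 := by
  obtain ⟨r, hr, e⟩ := exists_hasDerivAt_eq_slope f k hpq
    (fun x _ => (hf x).continuousAt.continuousWithinAt) (fun x _ => hf x)
  exact ⟨r, hr.1, hr.2, by rw [e]; apply div_neg_of_neg_of_pos <;> linarith⟩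

lemma f_nonpos (f k : ℝ → ℝ) (hf : ∀ x, HasDerivAt f (k x) x) (c : ℝ) (hc : 0 ≤ c)
    (hconv : ConvexOn ℝ (Icc 0 c) k) (hconc : ConcaveOn ℝ (Ici c) k)
    (μ v d : ℝ) (hv : 0 < v) (hd : 0 < d) (hdμ : d ≤ μ)
    (x1 x2 : ℝ) (hx1 : x1 = μ - d) (hx2 : x2 = μ + v / d)
    (hF : ∀ e, 0 < e → e ≤ μ → v * f (μ - e) + e ^ 2 * f (μ + v / e) ≤ 0)
    (hf1 : f x1 = 0) (hf2 : f x2 = 0) (hk2 : k x2 = 0) (hk1 : k x1 ≤ 0)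
    (hk1' : x1 = 0 ∨ k x1 = 0) (x : ℝ) (hx : 0 ≤ x) : f x ≤ 0 := by
  have hvd : 0 < v / d := by positivity
  by_contra! hpos
  have mid : ∀ z, x1 ≤ z → z ≤ x2 → f z ≤ 0 := by
    intro z h1 h2
    by_contra! hz
    have h1' : x1 < z := lt_of_le_of_ne h1 (by rintro rfl; linarith)
    have h2' : z < x2 := lt_of_le_of_ne h2 (by rintro rfl; linarith)
    obtain ⟨p, p1, p2, p3⟩ := exPos f k hf x1 z h1' (by linarith)
    obtain ⟨q, q1, q2, q3⟩ := exNeg f k hf z x2 h2' (by linarith)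
    exact noPattern k c hc hconv hconc x1 p q x2 (by linarith) p1 (by linarith) q2
      (by linarith) (by linarith) (by linarith)
  have dich : (∀ z, x1 ≤ z → z ≤ x2 → f z = 0) ∨
      ∃ b e, x1 < b ∧ b < e ∧ e < x2 ∧ k b < 0 ∧ 0 < k e := by
    by_cases hz : ∀ z, x1 ≤ z → z ≤ x2 → f z = 0
    · exact Or.inl hz
    right
    push Not at hz
    obtain ⟨z, h1, h2, h3⟩ := hz
    have h4 : f z < 0 := lt_of_le_of_ne (mid z h1 h2) h3
    have h1' : x1 < z := lt_of_le_of_ne h1 (by rintro rfl; linarith)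
    have h2' : z < x2 := lt_of_le_of_ne h2 (by rintro rfl; linarith)
    obtain ⟨p, p1, p2, p3⟩ := exNeg f k hf x1 z h1' (by linarith)
    obtain ⟨q, q1, q2, q3⟩ := exPos f k hf z x2 h2' (by linarith)
    exact ⟨p, q, p1, by linarith, q2, p3, q3⟩
  rcases lt_or_ge x x1 with hl | hl
  · have hk0 : k x1 = 0 := by
      rcases hk1' with h | h
      · linarith
      · exact h
    rcases dich with h0 | ⟨b, e, h1, h2, h3, h4, h5⟩
    · have e0 : 0 < μ - x := by linarith
      have h := hF (μ - x) e0 (by linarith)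
      have h6 : v / (μ - x) ≤ v / d := div_le_div_of_nonneg_left hv.le hd (by linarith)
      have h7 : 0 < v / (μ - x) := by positivity
      rw [h0 (μ + v / (μ - x)) (by linarith) (by linarith)] at h
      have : 0 < v * f x := by positivity
      simp only [sub_sub_cancel, mul_zero, add_zero] at h
      linarith
    · obtain ⟨p, p1, p2, p3⟩ := exNeg f k hf x x1 hl (by linarith)
      exact noPattern k c hc hconv hconc p x1 b e (by linarith) p2 h1 h2
        (by linarith) (by linarith) (by linarith)
  rcases le_or_gt x x2 with hr | hr
  · linarith [mid x hl hr]
  rcases dich with h0 | ⟨b, e, h1, h2, h3, h4, h5⟩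
  · have e0 : 0 < x - μ := by linarith
    have h6 : v / (x - μ) ≤ d := by
      rw [div_le_iff₀ e0]
      have : v / d * d = v := by field_simp
      nlinarith
    have h7 : 0 < v / (x - μ) := by positivity
    have h := hF (v / (x - μ)) h7 (by linarith)
    rw [h0 (μ - v / (x - μ)) (by linarith) (by linarith)] at h
    have h8 : μ + v / (v / (x - μ)) = x := by field_simp; ring
    rw [h8] at h
    have : 0 < (v / (x - μ)) ^ 2 * f x := by positivity
    linarith
  · obtain ⟨p, p1, p2, p3⟩ := exPos f k hf x2 x hr (by linarith)
    exact noPattern k c hc hconv hconc b e x2 p (by linarith) h2 h3 p1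
      (by linarith) (by linarith) (by linarith)

lemma convexOn_closure' (s : Set ℝ) (f : ℝ → ℝ) (hf : Continuous f) (h : ConvexOn ℝ s f) :
    ConvexOn ℝ (closure s) f := by
  refine ⟨h.1.closure, ?_⟩
  intro x hx y hy a b ha hb hab
  have hcl : IsClosed {p : ℝ × ℝ | f (a • p.1 + b • p.2) ≤ a • f p.1 + b • f p.2} :=
    isClosed_le (by fun_prop) (by fun_prop)
  have hsub : closure (s ×ˢ s) ⊆ {p : ℝ × ℝ | f (a • p.1 + b • p.2) ≤ a • f p.1 + b • f p.2} :=
    closure_minimal (fun p hp => h.2 hp.1 hp.2 ha hb hab) hcl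
  rw [closure_prod_eq] at hsub
  exact hsub (Set.mk_mem_prod hx hy)

lemma concaveOn_closure' (s : Set ℝ) (f : ℝ → ℝ) (hf : Continuous f) (h : ConcaveOn ℝ s f) :
    ConcaveOn ℝ (closure s) f := by
  have := convexOn_closure' s (-f) hf.neg h.neg
  simpa using this.neg

/-- two-point value -/
noncomputable def phi (H : ℝ → ℝ) (μ v d : ℝ) : ℝ :=
  (v * H (μ - d) + d ^ 2 * H (μ + v / d)) / (d ^ 2 + v)

lemma exists_max (H : ℝ → ℝ) (hcont : Continuous H) (hHc : ConvexOn ℝ (Ici 0) H)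
    (K : ℝ) (hK : ∀ x, 0 ≤ x → |H x| ≤ K * x) (μ v : ℝ) (hμ : 0 < μ) (hv : 0 < v) :
    ∃ d, 0 < d ∧ d ≤ μ ∧ ∀ e, 0 < e → e ≤ μ → phi H μ v e ≤ phi H μ v d := by
  have hcontphi : ContinuousOn (phi H μ v) (Icc 0 μ) := by
    unfold phi
    apply ContinuousOn.div _ (by fun_prop) (fun x _ => by positivity)
    apply ContinuousOn.add (by fun_prop)
    intro d hd
    rcases eq_or_lt_of_le hd.1 with h0 | h0
    · subst h0
      have hz : Tendsto (fun d : ℝ => K * (d ^ 2 * μ + d * v)) (𝓝[Icc 0 μ] 0) (𝓝 0) := by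
        have : Continuous (fun d : ℝ => K * (d ^ 2 * μ + d * v)) := by fun_prop
        have h2 := this.tendsto 0
        simp only [ne_eq, OfNat.ofNat_ne_zero, not_false_eq_true, zero_pow, zero_mul, add_zero,
          mul_zero] at h2
        exact h2.mono_left nhdsWithin_le_nhds
      unfold ContinuousWithinAt
      simp only [ne_eq, OfNat.ofNat_ne_zero, not_false_eq_true, zero_pow, zero_mul]
      apply squeeze_zero_norm' _ hz
      filter_upwards [self_mem_nhdsWithin] with d hd
      rcases eq_or_lt_of_le hd.1 with h1 | h1
      · subst h1; simp
      · rw [Real.norm_eq_abs, abs_mul, abs_of_nonneg (sq_nonneg d)]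
        have h3 := hK (μ + v / d) (by positivity)
        calc d ^ 2 * |H (μ + v / d)| ≤ d ^ 2 * (K * (μ + v / d)) := by gcongr
          _ = _ := by field_simp
    · apply ContinuousAt.continuousWithinAt
      have : ContinuousAt (fun d : ℝ => μ + v / d) d := by
        apply ContinuousAt.add (by fun_prop)
        exact ContinuousAt.div (by fun_prop) (by fun_prop) h0.ne'
      apply ContinuousAt.mul (by fun_prop)
      exact hcont.continuousAt.comp this
  obtain ⟨d, hd, hmax⟩ := isCompact_Icc.exists_isMaxOn (nonempty_Icc.2 hμ.le) hcontphi
  have hmax' : ∀ e, 0 < e → e ≤ μ → phi H μ v e ≤ phi H μ v d := fun e h1 h2 => hmax ⟨h1.le, h2⟩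
  rcases eq_or_lt_of_le hd.1 with h0 | h0
  · refine ⟨μ, hμ, le_rfl, fun e h1 h2 => (hmax' e h1 h2).trans ?_⟩
    subst h0
    have m1 : (0:ℝ) ∈ Ici (0:ℝ) := by simp
    have m2 : μ + v / μ ∈ Ici (0:ℝ) := by simp only [mem_Ici]; positivity
    have w1 : 0 ≤ v / (μ ^ 2 + v) := by positivity
    have w2 : 0 ≤ μ ^ 2 / (μ ^ 2 + v) := by positivity
    have w3 : v / (μ ^ 2 + v) + μ ^ 2 / (μ ^ 2 + v) = 1 := by field_simp; ring
    have hj := hHc.2 m1 m2 w1 w2 w3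
    have e1 : (v / (μ ^ 2 + v)) • (0:ℝ) + (μ ^ 2 / (μ ^ 2 + v)) • (μ + v / μ) = μ := by
      simp only [smul_eq_mul]; field_simp; ring
    rw [e1] at hj
    have e2 : phi H μ v 0 = H μ := by unfold phi; simp; field_simp
    rw [e2]
    refine hj.trans (le_of_eq ?_)
    unfold phi
    simp only [smul_eq_mul, sub_self]; field_simp
  · exact ⟨d, h0, hd.2, hmax'⟩

lemma core (G H : ℝ → ℝ) (hH : ∀ x, HasDerivAt H (G x) x) (c : ℝ) (hc : 0 ≤ c)
    (hconv : ConvexOn ℝ (Icc 0 c) G) (hconc : ConcaveOn ℝ (Ici c) G)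
    (hHc : ConvexOn ℝ (Ici 0) H)
    (K : ℝ) (hK : ∀ x, 0 ≤ x → |H x| ≤ K * x) (μ v : ℝ) (hμ : 0 < μ) (hv : 0 < v) :
    ∃ d, 0 < d ∧ d ≤ μ ∧ ∃ A B C : ℝ, (∀ x, 0 ≤ x → H x ≤ A + B * x + C * x ^ 2) ∧
      A + B * μ + C * (v + μ ^ 2) = phi H μ v d := by
  have hcont : Continuous H := continuous_iff_continuousAt.2 fun x => (hH x).continuousAt
  obtain ⟨d, hd, hdμ, hmax⟩ := exists_max H hcont hHc K hK μ v hμ hv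
  refine ⟨d, hd, hdμ, ?_⟩
  obtain ⟨x1, hx1⟩ : ∃ x1, x1 = μ - d := ⟨_, rfl⟩
  obtain ⟨x2, hx2⟩ : ∃ x2, x2 = μ + v / d := ⟨_, rfl⟩
  have hvd : 0 < v / d := by positivity
  have h12 : x2 - x1 ≠ 0 := by
    have : 0 < x2 - x1 := by linarith
    exact this.ne'
  obtain ⟨C, hC⟩ : ∃ C, C = (H x1 - H x2 + G x2 * (x2 - x1)) / (x2 - x1) ^ 2 := ⟨_, rfl⟩
  obtain ⟨B, hB⟩ : ∃ B, B = G x2 - 2 * C * x2 := ⟨_, rfl⟩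
  obtain ⟨A, hA⟩ : ∃ A, A = H x2 - G x2 * x2 + C * x2 ^ 2 := ⟨_, rfl⟩
  have hq1 : A + B * x1 + C * x1 ^ 2 = H x1 := by
    have : C * (x2 - x1) ^ 2 = H x1 - H x2 + G x2 * (x2 - x1) := by rw [hC]; field_simp
    rw [hA, hB]; linarith
  have hq2 : A + B * x2 + C * x2 ^ 2 = H x2 := by rw [hA, hB]; ring
  have hqE : ∀ e, 0 < e → v * (A + B * (μ - e) + C * (μ - e) ^ 2) +
      e ^ 2 * (A + B * (μ + v / e) + C * (μ + v / e) ^ 2) =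
      (A + B * μ + C * (v + μ ^ 2)) * (e ^ 2 + v) := by
    intro e he; field_simp; ring
  have hval : A + B * μ + C * (v + μ ^ 2) = phi H μ v d := by
    unfold phi
    rw [← hx1, ← hx2, ← hq1, ← hq2, hx1, hx2, hqE d hd]
    field_simp
  refine ⟨A, B, C, ?_, hval⟩
  set f : ℝ → ℝ := fun x => H x - (A + B * x + C * x ^ 2) with hfdef
  set k : ℝ → ℝ := fun x => G x - (B + 2 * C * x) with hkdef
  have hf : ∀ x, HasDerivAt f (k x) x := by
    intro x
    have h1 : HasDerivAt (fun x : ℝ => A + B * x + C * x ^ 2) (B + 2 * C * x) x := by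
      have := (((hasDerivAt_id x).const_mul B).const_add A).add
        (((hasDerivAt_id x).pow 2).const_mul C)
      exact this.congr_deriv (by simp; ring)
    exact (hH x).sub h1
  have hF : ∀ e, 0 < e → e ≤ μ → v * f (μ - e) + e ^ 2 * f (μ + v / e) ≤ 0 := by
    intro e h1 h2
    have h3 := hmax e h1 h2
    rw [← hval] at h3
    unfold phi at h3
    rw [div_le_iff₀ (by positivity), ← hqE e h1] at h3
    simp only [hfdef]
    linarith
  have hf1 : f x1 = 0 := by simp only [hfdef]; linarith
  have hf2 : f x2 = 0 := by simp only [hfdef]; linarith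
  have hk2 : k x2 = 0 := by simp only [hkdef]; rw [hB]; ring
  have hFd : HasDerivAt (fun e => v * f (μ - e) + e ^ 2 * f (μ + v / e)) (-(v * k x1)) d := by
    have a1 : HasDerivAt (fun e : ℝ => μ - e) (-1) d := (hasDerivAt_id d).const_sub μ
    have a2 : HasDerivAt (fun e : ℝ => μ + v / e) (-(v / d ^ 2)) d := by
      have := ((hasDerivAt_inv hd.ne').const_mul v).const_add μ
      exact this.congr_deriv (by field_simp)
    have b1 : HasDerivAt (fun e => f (μ - e)) (k x1 * (-1)) d :=
      HasDerivAt.comp d (h₂ := f) (h₂' := k x1) (by rw [hx1]; exact hf _) a1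
    have b2 : HasDerivAt (fun e => f (μ + v / e)) (k x2 * (-(v / d ^ 2))) d :=
      HasDerivAt.comp d (h₂ := f) (h₂' := k x2) (by rw [hx2]; exact hf _) a2
    have := (b1.const_mul v).add (((hasDerivAt_id d).pow 2).mul b2)
    exact this.congr_deriv (by simp [← hx2, hf2, hk2])
  have hF0 : v * f (μ - d) + d ^ 2 * f (μ + v / d) = 0 := by
    rw [← hx1, ← hx2, hf1, hf2]; ring
  have hk1 : k x1 ≤ 0 := by
    by_contra! hpos
    have hneg : -(v * k x1) < 0 := by
      have : 0 < v * k x1 := by positivity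
      linarith
    have : Tendsto (slope (fun e => v * f (μ - e) + e ^ 2 * f (μ + v / e)) d) (𝓝[<] d)
      (𝓝 (-(v * k x1))) :=
      (hasDerivAt_iff_tendsto_slope.1 hFd).mono_left (nhdsWithin_mono _ (fun x hx => ne_of_lt hx))
    have h1 := this.eventually (gt_mem_nhds hneg)
    have h2 : ∀ᶠ e in 𝓝[<] d, e ∈ Ioo 0 d := Ioo_mem_nhdsLT hd
    obtain ⟨e, h3, h4⟩ := (h1.and h2).exists
    rw [slope_def_field, hF0] at h3
    have h5 := hF e h4.1 (by linarith [h4.2])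
    have h6 : 0 ≤ (v * f (μ - e) + e ^ 2 * f (μ + v / e) - 0) / (e - d) :=
      div_nonneg_of_nonpos (by linarith) (by linarith [h4.2])
    linarith
  have hk1' : x1 = 0 ∨ k x1 = 0 := by
    rcases eq_or_lt_of_le hdμ with h | h
    · left; linarith
    right
    have hloc : IsLocalMax (fun e => v * f (μ - e) + e ^ 2 * f (μ + v / e)) d := by
      filter_upwards [Ioo_mem_nhds hd h] with e he
      rw [hF0]
      exact hF e he.1 he.2.le
    have := hloc.hasDerivAt_eq_zero hFd
    have h2 : v * k x1 = 0 := by linarith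
    exact (mul_eq_zero.1 h2).resolve_left hv.ne'
  have haff : ∀ s : Set ℝ, Convex ℝ s → ConvexOn ℝ s (fun x => B + 2 * C * x) ∧
      ConcaveOn ℝ s (fun x => B + 2 * C * x) := by
    intro s hs
    constructor
    · refine ⟨hs, fun x _ y _ a b _ _ hab => le_of_eq ?_⟩
      simp only [smul_eq_mul]; linear_combination (-B) * hab
    · refine ⟨hs, fun x _ y _ a b _ _ hab => le_of_eq ?_⟩
      simp only [smul_eq_mul]; linear_combination B * hab
  have hkconv : ConvexOn ℝ (Icc 0 c) k := hconv.sub (haff _ (convex_Icc _ _)).2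
  have hkconc : ConcaveOn ℝ (Ici c) k := hconc.sub (haff _ (convex_Ici _)).1
  intro x hx
  have := f_nonpos f k hf c hc hkconv hkconc μ v d hv hd hdμ x1 x2 hx1 hx2 hF hf1 hf2 hk2 hk1
    hk1' x hx
  simp only [hfdef] at this
  linarith

/-- truncated primitive -/
noncomputable def HN (G : ℝ → ℝ) (N x : ℝ) : ℝ := ∫ u in (0:ℝ)..x, G (min u N)

lemma HN_deriv (G : ℝ → ℝ) (hG : Continuous G) (N x : ℝ) :
    HasDerivAt (HN G N) (G (min x N)) x := by
  have hc : Continuous (fun u => G (min u N)) := by fun_prop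
  exact (hc.integral_hasStrictDerivAt 0 x).hasDerivAt

lemma mono_trunc (G : ℝ → ℝ) (hmono : MonotoneOn G (Ici 0)) (N : ℝ) (hN : 0 ≤ N) :
    MonotoneOn (fun x => G (min x N)) (Ici 0) := by
  intro x hx y hy hxy
  exact hmono (le_min hx hN) (le_min hy hN) (min_le_min_right N hxy)

lemma HN_bounds (G : ℝ → ℝ) (hG : Continuous G) (hG0 : G 0 = 0) (hmono : MonotoneOn G (Ici 0))
    (N : ℝ) (hN : 0 ≤ N) (x : ℝ) (hx : 0 ≤ x) :
    0 ≤ HN G N x ∧ HN G N x ≤ (∫ u in (0:ℝ)..x, G u) ∧ HN G N x ≤ G N * x := by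
  have hc : Continuous (fun u => G (min u N)) := by fun_prop
  refine ⟨?_, ?_, ?_⟩
  · apply intervalIntegral.integral_nonneg hx
    intro u hu
    rw [← hG0]
    exact hmono (by simp) (le_min hu.1 hN) (le_min hu.1 hN)
  · apply intervalIntegral.integral_mono_on hx (hc.intervalIntegrable _ _)
      (hG.intervalIntegrable _ _)
    intro u hu
    exact hmono (le_min hu.1 hN) hu.1 (min_le_left _ _)
  · have : HN G N x ≤ ∫ u in (0:ℝ)..x, G N := by
      apply intervalIntegral.integral_mono_on hx (hc.intervalIntegrable _ _)
        (by simp)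
      intro u hu
      exact hmono (le_min hu.1 hN) hN (min_le_right _ _)
    simp at this
    linarith

lemma HN_eq (G : ℝ → ℝ) (N x : ℝ) (hx : 0 ≤ x) (hxN : x ≤ N) :
    HN G N x = ∫ u in (0:ℝ)..x, G u := by
  apply intervalIntegral.integral_congr
  intro u hu
  rw [uIcc_of_le hx] at hu
  simp only
  rw [min_eq_left (hu.2.trans hxN)]

lemma trunc_shape (G : ℝ → ℝ) (hG : Continuous G) (hmono : MonotoneOn G (Ici 0))
    (N : ℝ) (hN : 0 ≤ N) (c : EReal) (hc : 0 ≤ c)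
    (h1 : ConvexOn ℝ {x : ℝ | 0 < x ∧ (x : EReal) < c} G)
    (h2 : ConcaveOn ℝ {x : ℝ | c < (x : EReal)} G) :
    ∃ c' : ℝ, 0 ≤ c' ∧ ConvexOn ℝ (Icc 0 c') (fun x => G (min x N)) ∧
      ConcaveOn ℝ (Ici c') (fun x => G (min x N)) := by
  have conv : ∀ c' : ℝ, 0 ≤ c' → c' ≤ N → (c' : EReal) ≤ c →
      ConvexOn ℝ (Icc 0 c') (fun x => G (min x N)) := by
    intro c' h0 hcN hcc
    have hG' : ConvexOn ℝ (Icc 0 c') G := by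
      rcases eq_or_lt_of_le h0 with h | h
      · subst h
        simp [ConvexOn]
        intro a b ha hb hab
        rw [← add_mul, hab, one_mul]
      · rw [← closure_Ioo h.ne]
        apply convexOn_closure' _ _ hG
        refine h1.subset ?_ (convex_Ioo _ _)
        intro x hx
        exact ⟨hx.1, lt_of_lt_of_le (EReal.coe_lt_coe_iff.2 hx.2) hcc⟩
    refine hG'.congr ?_
    intro x hx
    simp only
    rw [min_eq_left (hx.2.trans hcN)]
  rcases le_or_gt (N : EReal) c with h | h
  · refine ⟨N, hN, conv N hN le_rfl h, ?_⟩
    refine (concaveOn_const (G N) (convex_Ici N)).congr ?_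
    intro x hx
    simp only
    rw [min_eq_right hx]
  · obtain ⟨r, rfl⟩ : ∃ r : ℝ, c = r := by
      refine ⟨c.toReal, (EReal.coe_toReal ?_ ?_).symm⟩
      · rintro rfl; simp at h
      · rintro rfl; simp at hc
    have hr : 0 ≤ r := by exact_mod_cast hc
    have hrN : r < N := by exact_mod_cast h
    refine ⟨r, hr, conv r hr hrN.le le_rfl, ?_⟩
    have hG' : ConcaveOn ℝ (Ici r) G := by
      rw [← closure_Ioi]
      apply concaveOn_closure' _ _ hG
      refine h2.subset ?_ (convex_Ioi _)
      intro x hx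
      exact EReal.coe_lt_coe_iff.2 hx
    refine ⟨convex_Ici r, ?_⟩
    intro x hx y hy a b ha hb hab
    have hx' : min x N ∈ Ici r := le_min hx hrN.le
    have hy' : min y N ∈ Ici r := le_min hy hrN.le
    have k1 := hG'.2 hx' hy' ha hb hab
    have k3 : a • min x N + b • min y N ∈ Ici r := convex_Ici r hx' hy' ha hb hab
    have k4 : a • x + b • y ∈ Ici r := convex_Ici r hx hy ha hb hab
    have k2 : a • min x N + b • min y N ≤ min (a • x + b • y) N := by
      simp only [smul_eq_mul]
      apply le_min
      · have := mul_le_mul_of_nonneg_left (min_le_left x N) ha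
        have := mul_le_mul_of_nonneg_left (min_le_left y N) hb
        linarith
      · have := mul_le_mul_of_nonneg_left (min_le_right x N) ha
        have := mul_le_mul_of_nonneg_left (min_le_right y N) hb
        have : a * N + b * N = N := by rw [← add_mul, hab, one_mul]
        linarith
    exact k1.trans (hmono (hr.trans k3) (le_min (hr.trans k4) hN) k2)

lemma trunc_core (G : ℝ → ℝ) (hG : Continuous G) (hG0 : G 0 = 0) (hmono : MonotoneOn G (Ici 0))
    (N : ℝ) (hN : 0 ≤ N) (c : EReal) (hc : 0 ≤ c)
    (h1 : ConvexOn ℝ {x : ℝ | 0 < x ∧ (x : EReal) < c} G)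
    (h2 : ConcaveOn ℝ {x : ℝ | c < (x : EReal)} G) (μ v : ℝ) (hμ : 0 < μ) (hv : 0 < v) :
    ∃ d, 0 < d ∧ d ≤ μ ∧ ∃ A B C : ℝ, (∀ x, 0 ≤ x → HN G N x ≤ A + B * x + C * x ^ 2) ∧
      A + B * μ + C * (v + μ ^ 2) = phi (HN G N) μ v d := by
  obtain ⟨c', hc', hcv, hcc⟩ := trunc_shape G hG hmono N hN c hc h1 h2
  have hd := HN_deriv G hG N
  have hdiff : Differentiable ℝ (HN G N) := fun x => (hd x).differentiableAt
  refine core (fun x => G (min x N)) (HN G N) hd c' hc' hcv hcc ?_ (G N) ?_ μ v hμ hv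
  · apply MonotoneOn.convexOn_of_deriv (convex_Ici 0) hdiff.continuous.continuousOn
      hdiff.differentiableOn
    have : deriv (HN G N) = fun x => G (min x N) := funext fun x => (hd x).deriv
    rw [this]
    exact (mono_trunc G hmono N hN).mono interior_subset
  · intro x hx
    obtain ⟨b1, b2, b3⟩ := HN_bounds G hG hG0 hmono N hN x hx
    rw [abs_of_nonneg b1]
    exact b3

/-- two-point measure -/
noncomputable def twoPt (μ v d : ℝ) : Measure ℝ :=
  ENNReal.ofReal (v / (d ^ 2 + v)) • Measure.dirac (μ - d) +
    ENNReal.ofReal (d ^ 2 / (d ^ 2 + v)) • Measure.dirac (μ + v / d)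

lemma twoPt_integrable (μ v d : ℝ) (f : ℝ → ℝ) : Integrable f (twoPt μ v d) := by
  unfold twoPt
  apply Integrable.add_measure
  · exact (integrable_dirac (by simp)).smul_measure (by simp)
  · exact (integrable_dirac (by simp)).smul_measure (by simp)

lemma twoPt_integral (μ v d : ℝ) (hv : 0 < v) (f : ℝ → ℝ) :
    ∫ x, f x ∂(twoPt μ v d) = phi f μ v d := by
  unfold twoPt
  rw [integral_add_measure]
  · rw [integral_smul_measure, integral_smul_measure, integral_dirac, integral_dirac,
      ENNReal.toReal_ofReal (by positivity), ENNReal.toReal_ofReal (by positivity)]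
    unfold phi
    simp only [smul_eq_mul]
    field_simp
  · exact (integrable_dirac (by simp)).smul_measure (by simp)
  · exact (integrable_dirac (by simp)).smul_measure (by simp)

lemma twoPt_feasible (μ v d : ℝ) (hv : 0 < v) (hd : 0 < d) (hdμ : d ≤ μ) :
    MomFeasible μ (v + μ ^ 2) (twoPt μ v d) ∧ SuppAtMost 2 (twoPt μ v d) := by
  have hvd : 0 < v / d := by positivity
  refine ⟨⟨⟨?_⟩, ?_, twoPt_integrable _ _ _ _, twoPt_integrable _ _ _ _, ?_, ?_⟩, ?_⟩
  · unfold twoPt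
    simp only [Measure.coe_add, Measure.coe_smul, Pi.add_apply, Pi.smul_apply, measure_univ,
      smul_eq_mul, mul_one]
    rw [← ENNReal.ofReal_add (by positivity) (by positivity), ← ENNReal.ofReal_one]
    congr 1
    field_simp; ring
  · unfold twoPt
    simp only [Measure.coe_add, Measure.coe_smul, Pi.add_apply, Pi.smul_apply, smul_eq_mul]
    rw [Measure.dirac_apply' _ measurableSet_Iio, Measure.dirac_apply' _ measurableSet_Iio,
      indicator_of_notMem, indicator_of_notMem]
    · simp
    · simp only [mem_Iio, not_lt]; linarith
    · simp only [mem_Iio, not_lt]; linarith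
  · rw [twoPt_integral μ v d hv (fun x => x)]
    unfold phi; field_simp; ring
  · rw [twoPt_integral μ v d hv (fun x => x ^ 2)]
    unfold phi; field_simp; ring
  · refine ⟨{μ - d, μ + v / d}, Finset.card_le_two, ?_⟩
    unfold twoPt
    simp only [Measure.coe_add, Measure.coe_smul, Pi.add_apply, Pi.smul_apply, smul_eq_mul]
    have hm : MeasurableSet ((({μ - d, μ + v / d} : Finset ℝ) : Set ℝ)ᶜ) :=
      (Finset.measurableSet _).compl
    rw [Measure.dirac_apply' _ hm, Measure.dirac_apply' _ hm,
      indicator_of_notMem, indicator_of_notMem]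
    · simp
    · simp
    · simp

lemma supp_of_nonpos (μ σ : ℝ) (hv : σ - μ ^ 2 ≤ 0) (P : Measure ℝ) (hP : MomFeasible μ σ P) :
    SuppAtMost 2 P := by
  obtain ⟨hp, h0, i1, i2, e1, e2⟩ := hP
  have hi : Integrable (fun x : ℝ => (x - μ) ^ 2) P := by
    have : Integrable (fun x : ℝ => x ^ 2 - 2 * μ * x + μ ^ 2) P :=
      (i2.sub (i1.const_mul (2 * μ))).add (integrable_const _)
    refine this.congr (ae_of_all _ fun x => ?_)
    simp only; ring
  have e3 : ∫ x, (x - μ) ^ 2 ∂P = σ - μ ^ 2 := by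
    have : ∫ x, (x - μ) ^ 2 ∂P = ∫ x, (x ^ 2 - 2 * μ * x + μ ^ 2) ∂P := by
      congr 1; ext x; ring
    have i3 : Integrable (fun x : ℝ => x ^ 2 - 2 * μ * x) P := i2.sub (i1.const_mul (2 * μ))
    rw [this, integral_add i3 (integrable_const _),
      integral_sub i2 (i1.const_mul (2 * μ)), integral_const_mul, e1, e2]
    simp; ring
  have e4 : ∫ x, (x - μ) ^ 2 ∂P = 0 :=
    le_antisymm (by linarith) (integral_nonneg fun x => sq_nonneg _)
  rw [integral_eq_zero_iff_of_nonneg (fun x => sq_nonneg _) hi] at e4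
  refine ⟨{μ}, by simp, ?_⟩
  have : ∀ᵐ x ∂P, x = μ := by
    filter_upwards [e4] with x hx
    have : (x - μ) ^ 2 = 0 := hx
    have := pow_eq_zero_iff (two_ne_zero) |>.1 this
    linarith
  rw [ae_iff] at this
  convert this using 2
  ext x; simp

/-- Proposition (2-support reduction): under convexity of `H` and a convex–concave
property of `H′` (with break point `c`, possibly `∞`), `OPT(𝒫⁺)` has the same optimal
value as `OPT(𝒫₂⁺)`. -/
theorem OPT_eq_OPT2
    (a β η ν : ℝ) (hβ : 0 < β) (hη : 0 < η) (hν : 0 < ν)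
    (h : ℝ → ℝ) (hmeas : Measurable h) (hbd : ∃ M, ∀ x, |h x| ≤ M)
    (μ σ : ℝ) (hμ : μ = η / ν) (hσ : σ = 2 * β / ν)
    (hHconv : ConvexOn ℝ (Set.Ici (0:ℝ)) (Hfun a h))
    (hH' : ∃ c : EReal, 0 ≤ c ∧
      ConvexOn ℝ {x : ℝ | 0 < x ∧ (x : EReal) < c} (deriv (Hfun a h)) ∧
      ConcaveOn ℝ {x : ℝ | c < (x : EReal)} (deriv (Hfun a h))) :
    sSup {z : ℝ | ∃ P : Measure ℝ, MomFeasible μ σ P ∧ z = ν * ∫ x, Hfun a h x ∂P} =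
    sSup {z : ℝ | ∃ P : Measure ℝ, MomFeasible μ σ P ∧ SuppAtMost 2 P ∧
      z = ν * ∫ x, Hfun a h x ∂P} := by
  obtain ⟨M, hM⟩ := hbd
  obtain ⟨c, hc, hcv, hcc⟩ := hH'
  have hμ0 : 0 < μ := by rw [hμ]; positivity
  rcases le_or_gt (σ - μ ^ 2) 0 with hv | hv
  · congr 1
    ext z
    constructor
    · rintro ⟨P, hP, e⟩
      exact ⟨P, hP, supp_of_nonpos μ σ hv P hP, e⟩
    · rintro ⟨P, hP, _, e⟩
      exact ⟨P, hP, e⟩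
  obtain ⟨v, hvdef⟩ : ∃ v, v = σ - μ ^ 2 := ⟨_, rfl⟩
  rw [← hvdef] at hv
  have hσv : σ = v + μ ^ 2 := by linarith
  set G : ℝ → ℝ := fun u => ∫ v in (0:ℝ)..u, h (v + a) with hGdef
  have hM0 : 0 ≤ M := (abs_nonneg _).trans (hM 0)
  have hIntv : ∀ p q : ℝ, IntervalIntegrable (fun v => h (v + a)) volume p q := by
    intro p q
    refine (intervalIntegrable_const (c := M)).mono_fun
      (hmeas.comp (measurable_add_const a)).aestronglyMeasurable (ae_of_all _ fun x => ?_)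
    simp only [Real.norm_eq_abs]
    exact (hM _).trans (le_abs_self M)
  have hG : Continuous G := intervalIntegral.continuous_primitive hIntv 0
  have hG0 : G 0 = 0 := by simp [hGdef]
  have hHd : ∀ x, HasDerivAt (Hfun a h) (G x) x := fun x =>
    (hG.integral_hasStrictDerivAt 0 x).hasDerivAt
  have hdH : deriv (Hfun a h) = G := funext fun x => (hHd x).deriv
  have hHdiff : Differentiable ℝ (Hfun a h) := fun x => (hHd x).differentiableAt
  rw [hdH] at hcv hcc
  have hmono : MonotoneOn G (Ici 0) := by
    rw [← hdH]
    exact hHconv.monotoneOn_deriv (fun x _ => hHdiff x)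
  have hGM : ∀ u, 0 ≤ u → G u ≤ M * u := by
    intro u hu
    have : G u ≤ ∫ v in (0:ℝ)..u, M :=
      intervalIntegral.integral_mono_on hu (hIntv 0 u) (by simp)
        (fun x _ => (le_abs_self _).trans (hM _))
    simp at this
    linarith
  have hHeq : ∀ x, Hfun a h x = ∫ u in (0:ℝ)..x, G u := fun x => rfl
  have hHnn : ∀ x, 0 ≤ x → 0 ≤ Hfun a h x := fun x hx => by
    obtain ⟨b1, b2, _⟩ := HN_bounds G hG hG0 hmono x hx x hx
    exact b1.trans b2
  have hHle : ∀ x, 0 ≤ x → Hfun a h x ≤ M * x ^ 2 := fun x hx => by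
    obtain ⟨_, _, b3⟩ := HN_bounds G hG hG0 hmono x hx x hx
    rw [HN_eq G x x hx le_rfl] at b3
    have := mul_le_mul_of_nonneg_right (hGM x hx) hx
    rw [hHeq]
    nlinarith
  have hae : ∀ P : Measure ℝ, MomFeasible μ σ P → ∀ᵐ x ∂P, 0 ≤ x := by
    intro P hP
    rw [ae_iff]
    convert hP.2.1 using 2
    ext x; simp
  have hHint : ∀ P : Measure ℝ, MomFeasible μ σ P → Integrable (Hfun a h) P := by
    intro P hP
    refine (hP.2.2.2.1.const_mul M).mono' hHdiff.continuous.aestronglyMeasurable ?_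
    filter_upwards [hae P hP] with x hx
    rw [Real.norm_eq_abs, abs_of_nonneg (hHnn x hx)]
    exact hHle x hx
  have hbound : ∀ P : Measure ℝ, MomFeasible μ σ P → ∫ x, Hfun a h x ∂P ≤ M * σ := by
    intro P hP
    rw [← hP.2.2.2.2.2, ← integral_const_mul]
    apply integral_mono_ae (hHint P hP) (hP.2.2.2.1.const_mul M)
    filter_upwards [hae P hP] with x hx
    exact hHle x hx
  have hbdd : BddAbove {z : ℝ | ∃ P : Measure ℝ, MomFeasible μ σ P ∧ SuppAtMost 2 P ∧
      z = ν * ∫ x, Hfun a h x ∂P} := by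
    refine ⟨ν * (M * σ), ?_⟩
    rintro z ⟨P, hP, _, rfl⟩
    exact mul_le_mul_of_nonneg_left (hbound P hP) hν.le
  have hbdd1 : BddAbove {z : ℝ | ∃ P : Measure ℝ, MomFeasible μ σ P ∧
      z = ν * ∫ x, Hfun a h x ∂P} := by
    refine ⟨ν * (M * σ), ?_⟩
    rintro z ⟨P, hP, rfl⟩
    exact mul_le_mul_of_nonneg_left (hbound P hP) hν.le
  have htp : ∀ d, 0 < d → d ≤ μ →
      MomFeasible μ σ (twoPt μ v d) ∧ SuppAtMost 2 (twoPt μ v d) := by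
    intro d h1 h2
    rw [hσv]; exact twoPt_feasible μ v d hv h1 h2
  have hne := htp μ hμ0 le_rfl
  apply le_antisymm
  · refine csSup_le ⟨_, twoPt μ v μ, hne.1, rfl⟩ ?_
    rintro z ⟨P, hP, rfl⟩
    have hlim : Tendsto (fun n : ℕ => ν * ∫ x, HN G n x ∂P) atTop
        (𝓝 (ν * ∫ x, Hfun a h x ∂P)) := by
      apply Tendsto.const_mul
      apply tendsto_integral_of_dominated_convergence (Hfun a h)
      · intro n
        have : Differentiable ℝ (HN G n) := fun x => (HN_deriv G hG n x).differentiableAt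
        exact this.continuous.aestronglyMeasurable
      · exact hHint P hP
      · intro n
        filter_upwards [hae P hP] with x hx
        obtain ⟨b1, b2, _⟩ := HN_bounds G hG hG0 hmono n n.cast_nonneg x hx
        rw [Real.norm_eq_abs, abs_of_nonneg b1]
        exact b2
      · filter_upwards [hae P hP] with x hx
        apply tendsto_const_nhds.congr'
        filter_upwards [eventually_ge_atTop ⌈x⌉₊] with n hn
        rw [HN_eq G n x hx (Nat.ceil_le.1 hn)]
        rfl
    refine le_of_tendsto' hlim fun n => ?_
    obtain ⟨d, hd, hdμ, A, B, C, hq, hval⟩ :=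
      trunc_core G hG hG0 hmono n n.cast_nonneg c hc hcv hcc μ v hμ0 hv
    obtain ⟨f1, f2⟩ := htp d hd hdμ
    have s1 : ∫ x, HN G n x ∂P ≤ A + B * μ + C * (v + μ ^ 2) := by
      have := hP.1
      have i1 : Integrable (fun x : ℝ => A + B * x) P :=
        (integrable_const A).add (hP.2.2.1.const_mul B)
      have i2 : Integrable (fun x : ℝ => C * x ^ 2) P := hP.2.2.2.1.const_mul C
      have e : ∫ x, (A + B * x + C * x ^ 2) ∂P = A + B * μ + C * (v + μ ^ 2) := by
        rw [integral_add i1 i2, integral_add (integrable_const A) (hP.2.2.1.const_mul B),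
          integral_const_mul, integral_const_mul, hP.2.2.2.2.1, hP.2.2.2.2.2, hσv]
        simp
      rw [← e]
      apply integral_mono_of_nonneg _ (i1.add i2)
      · filter_upwards [hae P hP] with x hx using hq x hx
      · filter_upwards [hae P hP] with x hx
        exact (HN_bounds G hG hG0 hmono n n.cast_nonneg x hx).1
    have s2 : phi (HN G n) μ v d ≤ ∫ x, Hfun a h x ∂(twoPt μ v d) := by
      rw [← twoPt_integral μ v d hv]
      apply integral_mono_ae (twoPt_integrable _ _ _ _) (twoPt_integrable _ _ _ _)
      filter_upwards [hae _ f1] with x hx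
      exact (HN_bounds G hG hG0 hmono n n.cast_nonneg x hx).2.1
    calc ν * ∫ x, HN G n x ∂P ≤ ν * ∫ x, Hfun a h x ∂(twoPt μ v d) := by
          apply mul_le_mul_of_nonneg_left _ hν.le
          rw [hval] at s1
          exact s1.trans s2
      _ ≤ _ := le_csSup hbdd ⟨_, f1, f2, rfl⟩
  · refine csSup_le_csSup hbdd1 ⟨_, twoPt μ v μ, hne.1, hne.2, rfl⟩ ?_
    rintro z ⟨P, hP, _, e⟩
    exact ⟨P, hP, e⟩
end

section
/- Let a ∈ ℝ and β, η, ν > 0. Let h : ℝ → ℝ be bounded, nonnegative, non-decreasing on [a, c) and non-increasing on (c, ∞) for some c with a ≤ c ≤ ∞. Suppose the limit λ = lim_{x→∞} H(x)/x² exists and is finite, the worst-case tail problem with parameters (a, β, η, ν) is feasible, and λ = 0. Then there exists a feasible f* attaining the optimal value Z* of the worst-case tail problem. -/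
open MeasureTheory Set Filter Topology

/-- Structural properties of feasible functions. -/
def Nice (a η ν : ℝ) (f : ℝ → ℝ) : Prop :=
  f a = η ∧ ConvexOn ℝ (Set.Ici a) f ∧ (∀ x, a ≤ x → 0 ≤ f x) ∧
  (∀ x y, a ≤ x → x ≤ y → f y ≤ f x) ∧
  (∀ x, a ≤ x → η - ν * (x - a) ≤ f x)

lemma Feasible.nice {a β η ν : ℝ} {f : ℝ → ℝ} (hf : Feasible a β η ν f) : Nice a η ν f := by
  obtain ⟨hi, -, ha, -, ⟨d, hd⟩, hs, hc, h0⟩ := hf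
  have hd' : rightDeriv f a = d := hd.derivWithin (uniqueDiffWithinAt_Ioi a)
  refine ⟨ha, hc, h0, ?_, ?_⟩
  · intro x y hx hxy
    by_contra! hlt
    have hxy' : x < y := lt_of_le_of_ne hxy (by rintro rfl; exact lt_irrefl _ hlt)
    have key : ∀ z, y < z → f y ≤ f z := by
      intro z hz
      have h1 := hc.slope_mono_adjacent (x := x) (y := y) (z := z) hx
        (show a ≤ z by linarith) hxy' hz
      have h2 : 0 < (f y - f x) / (y - x) := div_pos (by linarith) (by linarith)
      have h3 : 0 < (f z - f y) / (z - y) := by linarith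
      have h4 : 0 < f z - f y := by
        by_contra! h5
        have := div_nonpos_of_nonpos_of_nonneg h5 (show 0 ≤ z - y by linarith)
        linarith
      linarith
    have hy : 0 < f y := lt_of_le_of_lt (h0 x hx) hlt
    have hi2 : IntegrableOn (fun _ : ℝ => f y) (Ioi y) := by
      refine Integrable.mono' (hi.mono_set (Ioi_subset_Ioi (by linarith : a ≤ y)))
        aestronglyMeasurable_const ?_
      refine (ae_restrict_iff' measurableSet_Ioi).2 (Eventually.of_forall fun z hz => ?_)
      rw [Real.norm_eq_abs, abs_of_pos hy]
      exact key z hz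
    rw [integrableOn_const_iff] at hi2
    simp [hy.ne'] at hi2
  · intro x hx
    rcases hx.eq_or_lt with rfl | hx'
    · simp [ha]
    have h1 : d ≤ slope f a x :=
      hc.le_slope_of_hasDerivWithinAt_Ioi (show a ∈ Ici a from le_refl a) hx hx' hd
    rw [slope_def_field, le_div_iff₀ (by linarith)] at h1
    rw [hd'] at hs
    have := mul_le_mul_of_nonneg_right hs (show 0 ≤ x - a by linarith)
    rw [ha] at h1
    linarith

lemma Nice.lip {a η ν : ℝ} {f : ℝ → ℝ} (hf : Nice a η ν f) (hν : 0 < ν) :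
    ∀ x y, a ≤ x → x ≤ y → f x - f y ≤ ν * (y - x) := by
  obtain ⟨ha, hc, h0, hm, hl⟩ := hf
  intro x y hx hxy
  rcases hxy.eq_or_lt with rfl | hxy'
  · simp
  rcases hx.eq_or_lt with rfl | hx'
  · have := hl y hxy
    linarith
  have h1 := hc.slope_mono_adjacent (x := a) (y := x) (z := y) (le_refl a)
        (show a ≤ y by linarith) hx' hxy'
  have h2 : -ν ≤ (f x - f a) / (x - a) := by
    rw [le_div_iff₀ (by linarith)]
    have := hl x hx
    rw [ha]; linarith
  have h3 := h2.trans h1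
  rw [le_div_iff₀ (by linarith)] at h3
  linarith

lemma Nice.feasible {a β η ν : ℝ} {f : ℝ → ℝ} (hf : Nice a η ν f)
    (hi : IntegrableOn f (Ioi a)) (hI : ∫ x in Ioi a, f x = β) : Feasible a β η ν f := by
  obtain ⟨ha, hc, h0, hm, hl⟩ := hf
  have hlow : ∀ x ∈ Ioi a, -ν ≤ slope f a x := by
    intro x hx
    have hx : a < x := hx
    rw [slope_def_field, le_div_iff₀ (by linarith), ha]
    have := hl x hx.le
    linarith
  have hmono : MonotoneOn (slope f a) (Ioi a) := by
    intro x hx y hy hxy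
    have hx : a < x := hx
    have hy : a < y := hy
    exact hc.slope_mono (show a ∈ Ici a from le_refl a) ⟨hx.le, hx.ne'⟩ ⟨hy.le, hy.ne'⟩ hxy
  have hbb : BddBelow (slope f a '' Ioi a) := by
    refine ⟨-ν, ?_⟩
    rintro _ ⟨x, hx, rfl⟩
    exact hlow x hx
  have ht := hmono.tendsto_nhdsGT hbb
  have hd : HasDerivWithinAt f (sInf (slope f a '' Ioi a)) (Ioi a) a := by
    rw [hasDerivWithinAt_iff_tendsto_slope' (by simp)]
    exact ht
  refine ⟨hi, hI, ha, ?_, ⟨_, hd⟩, ?_, hc, h0⟩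
  · exact continuousWithinAt_Ioi_iff_Ici.1 hd.continuousWithinAt
  · have : rightDeriv f a = _ := hd.derivWithin (uniqueDiffWithinAt_Ioi a)
    rw [this]
    refine le_csInf ⟨_, a + 1, by simp, rfl⟩ ?_
    rintro _ ⟨x, hx, rfl⟩
    exact hlow x hx

lemma exists_subseq {η ν : ℝ} (hν : 0 < ν) (u : ℕ → ℝ → ℝ)
    (hb : ∀ n x, u n x ∈ Icc 0 η) (hl : ∀ n x y, |u n x - u n y| ≤ ν * |x - y|) :
    ∃ φ : ℕ → ℕ, StrictMono φ ∧ ∃ f : ℝ → ℝ, ∀ x,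
      Tendsto (fun n => u (φ n) x) atTop (𝓝 (f x)) := by
  have hK : IsCompact (Set.pi univ (fun _ : ℚ => Icc (0:ℝ) η)) :=
    isCompact_univ_pi (fun _ => isCompact_Icc)
  obtain ⟨w, -, φ, hφ, hw⟩ := hK.tendsto_subseq (x := fun n (q : ℚ) => u n q)
    (fun n q _ => hb n q)
  rw [tendsto_pi_nhds] at hw
  have : ∀ x, ∃ y, Tendsto (fun n => u (φ n) x) atTop (𝓝 y) := by
    intro x
    apply cauchySeq_tendsto_of_complete
    rw [Metric.cauchySeq_iff']
    intro ε hε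
    obtain ⟨q, hq1, hq2⟩ := exists_rat_btwn (show x < x + ε / (3 * ν) by
      have : 0 < ε / (3 * ν) := by positivity
      linarith)
    have hxq : ν * |x - q| < ε / 3 := by
      rw [abs_sub_comm, abs_of_pos (by linarith)]
      calc ν * (q - x) < ν * (ε / (3 * ν)) := by
            apply mul_lt_mul_of_pos_left _ hν
            linarith
        _ = ε / 3 := by field_simp
    have hcs := (hw q).cauchySeq
    rw [Metric.cauchySeq_iff'] at hcs
    obtain ⟨N, hN⟩ := hcs (ε / 3) (by positivity)
    refine ⟨N, fun n hn => ?_⟩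
    have h1 := hN n hn
    simp only [Function.comp, Real.dist_eq] at h1 ⊢
    have h2 := hl (φ n) x q
    have h3 := hl (φ N) x q
    rw [abs_lt] at h1 ⊢
    rw [abs_le] at h2 h3
    constructor <;> linarith [h1.1, h1.2, h2.1, h2.2, h3.1, h3.2]
  choose f hf using this
  exact ⟨φ, hφ, f, hf⟩

lemma aemeas_h {a : ℝ} {h : ℝ → ℝ} (hquasi : ∃ c : EReal, (a : EReal) ≤ c ∧
      MonotoneOn h {x : ℝ | a ≤ x ∧ (x : EReal) < c} ∧
      AntitoneOn h {x : ℝ | c < (x : EReal)}) :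
    AEMeasurable h (volume.restrict (Ioi a)) := by
  obtain ⟨c, hac, hm, hanti⟩ := hquasi
  have hms1 : MeasurableSet {x : ℝ | a ≤ x ∧ (x : EReal) < c} :=
    (measurableSet_Ici (a := a)).inter
      (measurableSet_lt measurable_coe_real_ereal measurable_const)
  have hms2 : MeasurableSet {x : ℝ | c < (x : EReal)} :=
    measurableSet_lt measurable_const measurable_coe_real_ereal
  have h1 := aemeasurable_restrict_of_monotoneOn (μ := volume) hms1 hm
  have h2 := aemeasurable_restrict_of_antitoneOn (μ := volume) hms2 hanti
  have h3 : AEMeasurable h (volume.restrict {c.toReal}) := by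
    rw [Measure.restrict_singleton]
    simp
  have h4 := (aemeasurable_union_iff.2 ⟨aemeasurable_union_iff.2 ⟨h1, h2⟩, h3⟩)
  refine h4.mono_measure (Measure.restrict_mono ?_ le_rfl)
  intro x hx
  have hx : a < x := hx
  rcases lt_trichotomy (x : EReal) c with h | h | h
  · exact Or.inl (Or.inl ⟨hx.le, h⟩)
  · right; simp [← h]
  · exact Or.inl (Or.inr h)

lemma no_lower {a M : ℝ} {h : ℝ → ℝ} (hbd : ∀ x, |h x| ≤ M) (hpos : ∀ x, 0 ≤ h x)
    (hme : AEMeasurable h (volume.restrict (Ioi a)))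
    (hlam : Tendsto (fun x => Hfun a h x / x ^ 2) atTop (𝓝 0))
    {ε x0 : ℝ} (hε : 0 < ε) (hx0 : a ≤ x0) (hlow : ∀ x, x0 < x → ε ≤ h x) : False := by
  have hme' : AEMeasurable (fun v => h (v + a)) (volume.restrict (Ioi 0)) := by
    have hmp : MeasurePreserving (fun v : ℝ => v + a) (volume.restrict (Ioi 0))
        (volume.restrict (Ioi a)) := by
      have := (measurePreserving_add_right (volume : Measure ℝ) a).restrict_preimage
        (measurableSet_Ioi (a := a))
      simpa using this
    exact hme.comp_quasiMeasurePreserving hmp.quasiMeasurePreserving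
  have hii : ∀ x y, 0 ≤ x → 0 ≤ y → IntervalIntegrable (fun v => h (v + a)) volume x y := by
    intro x y hx hy
    refine (intervalIntegrable_const (c := M)).mono_fun' ?_ (Eventually.of_forall fun v => hbd _)
    refine (hme'.mono_measure (Measure.restrict_mono ?_ le_rfl)).aestronglyMeasurable
    intro z hz
    rw [uIoc, mem_Ioc] at hz
    exact lt_of_le_of_lt (le_min hx hy) hz.1
  set b := x0 - a with hb
  have hb0 : 0 ≤ b := by linarith
  set G : ℝ → ℝ := fun u => ∫ v in (0:ℝ)..u, h (v + a) with hG
  have hGl : ∀ u, 0 ≤ u → ε * (u - b) ≤ G u := by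
    intro u hu
    have hG0 : ∀ u, 0 ≤ u → 0 ≤ G u := fun u hu =>
      intervalIntegral.integral_nonneg hu (fun _ _ => hpos _)
    rcases le_total u b with hub | hub
    · have := hG0 u hu
      nlinarith
    · have h1 : G u = G b + ∫ v in b..u, h (v + a) :=
        (intervalIntegral.integral_add_adjacent_intervals (hii 0 b le_rfl hb0)
          (hii b u hb0 hu)).symm
      have h2 : ∫ v in b..u, ε ≤ ∫ v in b..u, h (v + a) := by
        apply intervalIntegral.integral_mono_on_of_le_Ioo hub intervalIntegrable_const
          (hii b u hb0 hu)
        intro v hv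
        exact hlow _ (by linarith [hv.1])
      rw [intervalIntegral.integral_const, smul_eq_mul] at h2
      have := hG0 b hb0
      linarith
  have hGi : ∀ x, 0 ≤ x → IntervalIntegrable G volume 0 x := by
    intro x hx
    apply ContinuousOn.intervalIntegrable
    rw [uIcc_of_le hx]
    have := intervalIntegral.continuousOn_primitive_interval
      (f := fun v => h (v + a)) (μ := volume) (a := 0) (b := x)
      ((intervalIntegrable_iff_integrableOn_Icc_of_le hx).1 (hii 0 x le_rfl hx) |>.mono_set
        (by rw [uIcc_of_le hx]))
    rwa [uIcc_of_le hx] at this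
  have hH : ∀ x, 0 ≤ x → ε * (x ^ 2 / 2 - b * x) ≤ Hfun a h x := by
    intro x hx
    have h1 : ∫ u in (0:ℝ)..x, ε * (u - b) ≤ ∫ u in (0:ℝ)..x, G u := by
      apply intervalIntegral.integral_mono_on hx _ (hGi x hx)
      · intro u hu
        exact hGl u hu.1
      · exact (by fun_prop : Continuous fun u : ℝ => ε * (u - b)).intervalIntegrable _ _
    have h2 : ∫ u in (0:ℝ)..x, ε * (u - b) = ε * (x ^ 2 / 2 - b * x) := by
      rw [intervalIntegral.integral_const_mul, intervalIntegral.integral_sub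
        (continuous_id'.intervalIntegrable _ _) intervalIntegrable_const, integral_id,
        intervalIntegral.integral_const, smul_eq_mul]
      ring
    rw [h2] at h1
    exact h1
  have hev := (hlam.eventually_lt_const (show (0:ℝ) < ε / 4 by positivity))
  obtain ⟨x, hx1, hx2, hx3⟩ := (hev.and ((eventually_gt_atTop 0).and
    (eventually_gt_atTop (4 * b)))).exists
  rw [div_lt_iff₀ (by positivity)] at hx1
  have := hH x hx2.le
  nlinarith [mul_pos hε (mul_pos hx2 (sub_pos.2 hx3))]

lemma h_tail {a M : ℝ} {h : ℝ → ℝ} (hbd : ∀ x, |h x| ≤ M) (hpos : ∀ x, 0 ≤ h x)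
    (hquasi : ∃ c : EReal, (a : EReal) ≤ c ∧
      MonotoneOn h {x : ℝ | a ≤ x ∧ (x : EReal) < c} ∧
      AntitoneOn h {x : ℝ | c < (x : EReal)})
    (hlam : Tendsto (fun x => Hfun a h x / x ^ 2) atTop (𝓝 0)) {ε : ℝ} (hε : 0 < ε) :
    ∃ R, a ≤ R ∧ ∀ x, R < x → h x ≤ ε := by
  have hme := aemeas_h hquasi
  obtain ⟨c, hac, hm, hanti⟩ := hquasi
  by_contra! hcon
  induction c using EReal.rec with
  | bot => simp at hac
  | top =>
    obtain ⟨x, hx, hx'⟩ := hcon a le_rfl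
    refine no_lower hbd hpos hme hlam hε hx.le (fun y hy => ?_)
    exact hx'.le.trans (hm ⟨hx.le, EReal.coe_lt_top _⟩
      ⟨(hx.trans hy).le, EReal.coe_lt_top _⟩ hy.le)
  | coe c =>
    have hac : a ≤ c := by exact_mod_cast hac
    refine no_lower hbd hpos hme hlam hε hac (fun y hy => ?_)
    obtain ⟨x, hx, hx'⟩ := hcon y (hac.trans hy.le)
    refine hx'.le.trans (hanti ?_ ?_ hx.le)
    · exact_mod_cast hy
    · exact_mod_cast hy.trans hx

lemma Nice.line_max {a η ν s : ℝ} {f : ℝ → ℝ} (hf : Nice a η ν f) (hs : 0 < s) :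
    Nice a η ν (fun x => max (f x) (η - s * (x - a))) := by
  obtain ⟨ha, hc, h0, hm, hl⟩ := hf
  refine ⟨by simp [ha], ?_, fun x hx => le_max_of_le_left (h0 x hx), ?_,
    fun x hx => le_max_of_le_left (hl x hx)⟩
  · refine hc.sup ⟨convex_Ici a, ?_⟩
    intro x _ y _ p q _ _ hpq
    simp only [smul_eq_mul]
    apply le_of_eq
    linear_combination (-η - s * a) * hpq
  · intro x y hx hxy
    exact max_le_max (hm x y hx hxy) (by nlinarith)

/-- Filling the lost mass. -/
lemma exists_fill {a β η ν : ℝ} (hβ : 0 < β) (hη : 0 < η) (hν : 0 < ν) {f : ℝ → ℝ}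
    (hf : Nice a η ν f) (hi : IntegrableOn f (Ioi a)) (hI : ∫ x in Ioi a, f x ≤ β) :
    ∃ g, Feasible a β η ν g ∧ ∀ x, f x ≤ g x := by
  set g : ℝ → ℝ → ℝ := fun s x => max (f x) (η - s * (x - a)) with hg
  have hnice : ∀ s, 0 < s → Nice a η ν (g s) := fun s hs => hf.line_max hs
  have hmeas : ∀ s, AEStronglyMeasurable (g s) (volume.restrict (Ioi a)) := fun s =>
    hi.aestronglyMeasurable.sup (by fun_prop : Continuous fun x : ℝ =>
      (η - s * (x - a))).aestronglyMeasurable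
  have hgi : ∀ s, 0 < s → IntegrableOn (g s) (Ioi a) := by
    intro s hs
    have h1 : IntegrableOn ((Ioc a (a + η / s)).indicator fun _ => η) (Ioi a) := by
      apply Integrable.integrableOn
      rw [integrable_indicator_iff measurableSet_Ioc]
      exact integrableOn_const (by simp)
    refine Integrable.mono' (hi.add h1) (hmeas s) ?_
    refine (ae_restrict_iff' measurableSet_Ioi).2 (Eventually.of_forall fun x hx => ?_)
    have hx : a < x := hx
    have hfx := hf.2.2.1 x hx.le
    rw [Real.norm_eq_abs, abs_of_nonneg ((hnice s hs).2.2.1 x hx.le)]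
    simp only [Pi.add_apply]
    by_cases hxs : x ≤ a + η / s
    · rw [indicator_of_mem (show x ∈ Ioc a (a + η / s) from ⟨hx, hxs⟩)]
      apply max_le
      · linarith
      · nlinarith
    · rw [indicator_of_notMem (fun h => hxs h.2)]
      apply max_le
      · linarith
      · push Not at hxs
        have : η / s < x - a := by linarith
        rw [div_lt_iff₀ hs] at this
        linarith
  set s0 := min ν (η ^ 2 / (4 * β)) with hs0
  have hs0p : 0 < s0 := lt_min hν (by positivity)
  have hcont : ContinuousOn (fun s => ∫ x in Ioi a, g s x) (Icc s0 ν) := by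
    refine continuousOn_of_dominated (bound := g s0) (fun s _ => hmeas s) ?_ (hgi s0 hs0p) ?_
    · intro s hs
      refine (ae_restrict_iff' measurableSet_Ioi).2 (Eventually.of_forall fun x hx => ?_)
      have hx : a < x := hx
      rw [Real.norm_eq_abs, abs_of_nonneg ((hnice s (hs0p.trans_le hs.1)).2.2.1 x hx.le)]
      exact max_le_max le_rfl (by nlinarith [hs.1])
    · refine Eventually.of_forall fun x => ?_
      exact (by fun_prop : Continuous fun s : ℝ => max (f x) (η - s * (x - a))).continuousOn
  have hend : ∫ x in Ioi a, g ν x ≤ β := by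
    refine le_of_eq_of_le (setIntegral_congr_fun measurableSet_Ioi fun x hx => ?_) hI
    exact max_eq_left (hf.2.2.2.2 x (le_of_lt hx))
  have hstart : β ≤ ∫ x in Ioi a, g s0 x := by
    have h1 : ∫ x in Ioc a (a + η / (2 * s0)), η / 2 ≤ ∫ x in Ioc a (a + η / (2 * s0)), g s0 x := by
      refine setIntegral_mono_on (integrableOn_const (by simp))
        ((hgi s0 hs0p).mono_set Ioc_subset_Ioi_self) measurableSet_Ioc ?_
      intro x hx
      apply le_max_of_le_right
      have : x - a ≤ η / (2 * s0) := by linarith [hx.2]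
      rw [le_div_iff₀ (by positivity)] at this
      linarith
    have h2 : ∫ x in Ioc a (a + η / (2 * s0)), g s0 x ≤ ∫ x in Ioi a, g s0 x := by
      refine setIntegral_mono_set (hgi s0 hs0p) ?_ Ioc_subset_Ioi_self.eventuallyLE
      exact (ae_restrict_iff' measurableSet_Ioi).2
        (Eventually.of_forall fun x hx => (hnice s0 hs0p).2.2.1 x (le_of_lt hx))
    have h3 : ∫ x in Ioc a (a + η / (2 * s0)), η / 2 = η ^ 2 / (4 * s0) := by
      have : 0 ≤ η / (2 * s0) := by positivity
      rw [setIntegral_const, Measure.real, Real.volume_Ioc, ENNReal.toReal_ofReal (by linarith), smul_eq_mul]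
      field_simp
      ring
    have h4 : β ≤ η ^ 2 / (4 * s0) := by
      rw [le_div_iff₀ (by positivity)]
      have : s0 ≤ η ^ 2 / (4 * β) := min_le_right _ _
      rw [le_div_iff₀ (by positivity)] at this
      linarith
    linarith
  obtain ⟨s, hs, hs'⟩ := intermediate_value_Icc' (min_le_left _ _) hcont ⟨hend, hstart⟩
  have hsp := hs0p.trans_le hs.1
  exact ⟨g s, (hnice s hsp).feasible (hgi s hsp) hs', fun x => le_max_left _ _⟩

/-- Corollary: if `h` is bounded, nonnegative and quasi-concave on `[a, ∞)`
(non-decreasing on `[a, c)`, non-increasing on `(c, ∞)` for some `a ≤ c ≤ ∞`),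
the limit `λ = lim H(x)/x²` exists with `λ = 0`, and the problem is feasible,
then the worst-case tail problem admits an optimal solution. -/
theorem optimal_solution_exists_of_lambda_zero
    (a β η ν : ℝ) (hβ : 0 < β) (hη : 0 < η) (hν : 0 < ν)
    (h : ℝ → ℝ) (hbd : ∃ M, ∀ x, |h x| ≤ M) (hpos : ∀ x, 0 ≤ h x)
    (hquasi : ∃ c : EReal, (a : EReal) ≤ c ∧
      MonotoneOn h {x : ℝ | a ≤ x ∧ (x : EReal) < c} ∧
      AntitoneOn h {x : ℝ | c < (x : EReal)})
    (hlam : Tendsto (fun x => Hfun a h x / x ^ 2) atTop (𝓝 0))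
    (hfeas : ∃ f : ℝ → ℝ, Feasible a β η ν f) :
    ∃ f : ℝ → ℝ, Feasible a β η ν f ∧
      (∫ x in Set.Ioi a, h x * f x) =
        sSup {z : ℝ | ∃ g : ℝ → ℝ, Feasible a β η ν g ∧
          z = ∫ x in Set.Ioi a, h x * g x} := by
  obtain ⟨M, hM⟩ := hbd
  have hM0 : 0 ≤ M := (abs_nonneg _).trans (hM 0)
  have hme := (aemeas_h hquasi).aestronglyMeasurable
  have htail := fun (ε : ℝ) (hε : 0 < ε) => h_tail hM hpos hquasi hlam hε
  set S := {z : ℝ | ∃ g : ℝ → ℝ, Feasible a β η ν g ∧ z = ∫ x in Set.Ioi a, h x * g x} with hS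
  have hInt : ∀ g, IntegrableOn g (Ioi a) → IntegrableOn (fun x => h x * g x) (Ioi a) :=
    fun g hg => Integrable.bdd_mul hg hme (Eventually.of_forall hM)
  have hbdd : BddAbove S := by
    refine ⟨M * β, ?_⟩
    rintro _ ⟨g, hg, rfl⟩
    rw [← hg.2.1, ← integral_const_mul]
    refine setIntegral_mono_on (hInt g hg.1) (hg.1.const_mul M) measurableSet_Ioi ?_
    intro x hx
    exact mul_le_mul_of_nonneg_right ((le_abs_self _).trans (hM x))
      (hg.nice.2.2.1 x (le_of_lt hx))
  have hne : S.Nonempty := by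
    obtain ⟨f, hf⟩ := hfeas
    exact ⟨_, f, hf, rfl⟩
  obtain ⟨z, -, hz, hzS⟩ := exists_seq_tendsto_sSup hne hbdd
  choose F hF hzF using hzS
  have hFn := fun n => (hF n).nice
  obtain ⟨φ, hφ, f, hf⟩ := exists_subseq (η := η) hν (fun n x => F n (max x a))
    (fun n x => by
      refine ⟨(hFn n).2.2.1 _ (le_max_right _ _), ?_⟩
      have := (hFn n).2.2.2.1 a (max x a) le_rfl (le_max_right _ _)
      rwa [(hFn n).1] at this)
    (fun n x y => by
      have key : ∀ x y, x ≤ y → |F n (max x a) - F n (max y a)| ≤ ν * |x - y| := by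
        intro x y hxy
        have hmm : max x a ≤ max y a := max_le_max hxy le_rfl
        have h1 := (hFn n).2.2.2.1 _ _ (le_max_right x a) hmm
        have h2 := (hFn n).lip hν _ _ (le_max_right x a) hmm
        have h3 : max y a - max x a ≤ |x - y| := by
          have := abs_max_sub_max_le_abs x y a
          rw [abs_sub_comm, abs_of_nonneg (by linarith)] at this
          exact this
        rw [abs_of_nonneg (by linarith)]
        exact h2.trans (mul_le_mul_of_nonneg_left h3 hν.le)
      rcases le_total x y with hxy | hxy
      · exact key x y hxy
      · rw [abs_sub_comm, abs_sub_comm x y]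
        exact key y x hxy)
  have hfx : ∀ x, a ≤ x → Tendsto (fun n => F (φ n) x) atTop (𝓝 (f x)) := by
    intro x hx
    have := hf x
    simpa only [max_eq_left hx] using this
  have hnice : Nice a η ν f := by
    refine ⟨?_, ⟨convex_Ici a, ?_⟩, ?_, ?_, ?_⟩
    · refine tendsto_nhds_unique (hfx a le_rfl) ?_
      simp only [(hFn _).1]
      exact tendsto_const_nhds
    · intro x hx y hy p q hp hq hpq
      have hxy := convex_Ici a hx hy hp hq hpq
      exact le_of_tendsto_of_tendsto' (hfx _ hxy)
        (((hfx x hx).const_mul p).add ((hfx y hy).const_mul q))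
        (fun n => (hFn (φ n)).2.1.2 hx hy hp hq hpq)
    · intro x hx
      exact ge_of_tendsto' (hfx x hx) (fun n => (hFn (φ n)).2.2.1 x hx)
    · intro x y hx hxy
      exact le_of_tendsto_of_tendsto' (hfx y (hx.trans hxy)) (hfx x hx)
        (fun n => (hFn (φ n)).2.2.2.1 x y hx hxy)
    · intro x hx
      exact ge_of_tendsto' (hfx x hx) (fun n => (hFn (φ n)).2.2.2.2 x hx)
  have hFb : ∀ n x, a < x → ‖F n x‖ ≤ η := by
    intro n x hx
    rw [Real.norm_eq_abs, abs_of_nonneg ((hFn n).2.2.1 x hx.le)]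
    have := (hFn n).2.2.2.1 a x le_rfl hx.le
    rwa [(hFn n).1] at this
  have hfb : ∀ x, a < x → ‖f x‖ ≤ η := fun x hx =>
    le_of_tendsto' (hfx x hx.le).norm (fun n => hFb _ x hx)
  have hfmeas : AEStronglyMeasurable f (volume.restrict (Ioi a)) :=
    aestronglyMeasurable_of_tendsto_ae atTop (fun n => (hF (φ n)).1.aestronglyMeasurable)
      ((ae_restrict_iff' measurableSet_Ioi).2 (Eventually.of_forall fun x hx => hfx x (le_of_lt hx)))
  have hfR : ∀ R, IntegrableOn f (Ioc a R) := by
    intro R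
    refine Integrable.mono' (integrableOn_const (C := η) (by simp))
      (hfmeas.mono_measure (Measure.restrict_mono Ioc_subset_Ioi_self le_rfl)) ?_
    exact (ae_restrict_iff' measurableSet_Ioc).2 (Eventually.of_forall fun x hx => hfb x hx.1)
  have hconv : ∀ (k : ℝ → ℝ) (C : ℝ), (∀ x, |k x| ≤ C) →
      AEStronglyMeasurable k (volume.restrict (Ioi a)) → ∀ R,
      Tendsto (fun n => ∫ x in Ioc a R, k x * F (φ n) x) atTop
        (𝓝 (∫ x in Ioc a R, k x * f x)) := by
    intro k C hC hk R
    have hC0 : 0 ≤ C := (abs_nonneg _).trans (hC 0)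
    refine tendsto_integral_of_dominated_convergence (fun _ => C * η) ?_
      (integrableOn_const (by simp)) ?_ ?_
    · intro n
      exact (hk.mul (hF (φ n)).1.aestronglyMeasurable).mono_measure
        (Measure.restrict_mono Ioc_subset_Ioi_self le_rfl)
    · intro n
      refine (ae_restrict_iff' measurableSet_Ioc).2 (Eventually.of_forall fun x hx => ?_)
      rw [norm_mul]
      exact mul_le_mul (hC x) (hFb _ x hx.1) (norm_nonneg _) hC0
    · exact (ae_restrict_iff' measurableSet_Ioc).2
        (Eventually.of_forall fun x hx => (hfx x hx.1.le).const_mul _)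
  have hfle : ∀ R, ∫ x in Ioc a R, f x ≤ β := by
    intro R
    have h1 := hconv (fun _ => 1) 1 (by simp) aestronglyMeasurable_const R
    simp only [one_mul] at h1
    refine le_of_tendsto' h1 (fun n => ?_)
    rw [← (hF (φ n)).2.1]
    refine setIntegral_mono_set (hF (φ n)).1 ?_ Ioc_subset_Ioi_self.eventuallyLE
    exact (ae_restrict_iff' measurableSet_Ioi).2
      (Eventually.of_forall fun x hx => (hFn (φ n)).2.2.1 x (le_of_lt hx))
  have hfi : IntegrableOn f (Ioi a) := by
    refine integrableOn_Ioi_of_intervalIntegral_norm_bounded (l := atTop) (b := id) β a hfR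
      tendsto_id ?_
    filter_upwards [eventually_ge_atTop a] with R hR
    rw [id, intervalIntegral.integral_of_le hR]
    refine le_of_eq_of_le (setIntegral_congr_fun measurableSet_Ioc fun x hx => ?_) (hfle R)
    exact abs_of_nonneg (hnice.2.2.1 x hx.1.le)
  have hfI : ∫ x in Ioi a, f x ≤ β := by
    refine le_of_tendsto (intervalIntegral_tendsto_integral_Ioi a hfi tendsto_id) ?_
    filter_upwards [eventually_ge_atTop a] with R hR
    rw [id, intervalIntegral.integral_of_le hR]
    exact hfle R
  obtain ⟨g, hg, hfg⟩ := exists_fill hβ hη hν hnice hfi hfI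
  refine ⟨g, hg, le_antisymm (le_csSup hbdd ⟨g, hg, rfl⟩) ?_⟩
  have hmain : sSup S ≤ ∫ x in Ioi a, h x * f x := by
    apply le_of_forall_pos_le_add
    intro ε hε
    obtain ⟨R, haR, hR⟩ := htail (ε / β) (by positivity)
    have h1 : sSup S ≤ (∫ x in Ioc a R, h x * f x) + ε := by
      refine le_of_tendsto_of_tendsto' (hz.comp hφ.tendsto_atTop)
        ((hconv h M hM hme R).add_const ε) (fun n => ?_)
      simp only [Function.comp]
      rw [hzF (φ n)]
      have hi := hInt _ (hF (φ n)).1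
      rw [← Ioc_union_Ioi_eq_Ioi haR, setIntegral_union (by
        rw [Set.disjoint_left]; intro x hx hx'; exact absurd hx.2 (not_le.2 hx')) measurableSet_Ioi
        (hi.mono_set Ioc_subset_Ioi_self) (hi.mono_set (Ioi_subset_Ioi haR))]
      have h2 : ∫ x in Ioi R, h x * F (φ n) x ≤ ∫ x in Ioi R, ε / β * F (φ n) x := by
        refine setIntegral_mono_on (hi.mono_set (Ioi_subset_Ioi haR))
          (((hF (φ n)).1.mono_set (Ioi_subset_Ioi haR)).const_mul _) measurableSet_Ioi ?_
        intro x hx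
        exact mul_le_mul_of_nonneg_right (hR x hx)
          ((hFn (φ n)).2.2.1 x (haR.trans (le_of_lt hx)))
      have h3 : ∫ x in Ioi R, F (φ n) x ≤ β := by
        rw [← (hF (φ n)).2.1]
        refine setIntegral_mono_set (hF (φ n)).1 ?_ (Ioi_subset_Ioi haR).eventuallyLE
        exact (ae_restrict_iff' measurableSet_Ioi).2
          (Eventually.of_forall fun x hx => (hFn (φ n)).2.2.1 x (le_of_lt hx))
      rw [integral_const_mul] at h2
      have h4 : ε / β * ∫ x in Ioi R, F (φ n) x ≤ ε / β * β :=
        mul_le_mul_of_nonneg_left h3 (by positivity)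
      rw [div_mul_cancel₀ _ hβ.ne'] at h4
      linarith
    have h2 : ∫ x in Ioc a R, h x * f x ≤ ∫ x in Ioi a, h x * f x := by
      refine setIntegral_mono_set (hInt f hfi) ?_ Ioc_subset_Ioi_self.eventuallyLE
      exact (ae_restrict_iff' measurableSet_Ioi).2
        (Eventually.of_forall fun x hx => mul_nonneg (hpos x) (hnice.2.2.1 x (le_of_lt hx)))
    linarith
  refine hmain.trans ?_
  exact setIntegral_mono_on (hInt f hfi) (hInt g hg.1) measurableSet_Ioi
    (fun x _ => mul_le_mul_of_nonneg_left (hfg x) (hpos x))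
end

section
/- Let a ∈ ℝ and β, η, ν > 0. Let h : ℝ → ℝ be bounded, nonnegative, non-decreasing on [a, c) and non-increasing on (c, ∞) for some c with a ≤ c ≤ ∞. Suppose the worst-case tail problem with parameters (a, β, η, ν) is feasible with optimal value Z*. Then either (1) there exists a feasible f* whose restriction to [a, ∞) lies in 𝒫ℒ₂⁺[a, ∞) and which attains Z*; or (2) no feasible f attains Z*, and there exists a sequence of feasible functions f⁽ᵏ⁾ whose restrictions to [a, ∞) lie in 𝒫ℒ₂⁺[a, ∞) with ∫_a^∞ h(x) f⁽ᵏ⁾(x) dx → Z*, such that the right endpoint of the support of f⁽ᵏ⁾ tends to ∞ and the slope of its last line segment increases to 0 from below as k → ∞. -/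
open MeasureTheory Set Filter Topology

/-- The restriction of `f` to `[a, ∞)` is nonnegative, continuous, piecewise linear
with at most `m` segments, and vanishes beyond the last kink (the class `𝒫ℒ_m⁺[a, ∞)`). -/
def PLplus (a : ℝ) (m : ℕ) (f : ℝ → ℝ) : Prop :=
  (∀ x, a ≤ x → 0 ≤ f x) ∧ ContinuousOn f (Set.Ici a) ∧
  ∃ y : ℕ → ℝ, y 0 = a ∧ (∀ j, j < m → y j ≤ y (j + 1)) ∧
    (∀ j, j < m → ∃ c d : ℝ, ∀ x ∈ Set.Icc (y j) (y (j + 1)), f x = c + d * x) ∧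
    (∀ x, y m < x → f x = 0)


noncomputable def gfun (b v ν r x : ℝ) : ℝ :=
  ν * v / (r ^ 2 + v) * max (b - r - x) 0 + ν * r ^ 2 / (r ^ 2 + v) * max (b + v / r - x) 0

lemma gfun_left {b v ν r x : ℝ} (hv : 0 ≤ v) (hr : 0 < r) (hx : x ≤ b - r) :
    gfun b v ν r x = ν * (b - x) := by
  have h1 : 0 ≤ v / r := by positivity
  have h2 : r ^ 2 + v ≠ 0 := by positivity
  unfold gfun
  rw [max_eq_left (by linarith), max_eq_left (by linarith)]
  field_simp
  ring

lemma gfun_mid {b v ν r x : ℝ} (hx : b - r ≤ x) (hx' : x ≤ b + v / r) :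
    gfun b v ν r x = ν * r ^ 2 / (r ^ 2 + v) * (b + v / r - x) := by
  unfold gfun
  rw [max_eq_right (by linarith), max_eq_left (by linarith)]
  ring

lemma gfun_right {b v ν r x : ℝ} (hv : 0 ≤ v) (hr : 0 < r) (hx : b + v / r ≤ x) :
    gfun b v ν r x = 0 := by
  have h1 : 0 ≤ v / r := by positivity
  unfold gfun
  rw [max_eq_right (by linarith), max_eq_right (by linarith)]
  ring

lemma gfun_nonneg {b v ν r x : ℝ} (hν : 0 < ν) (hv : 0 ≤ v) (hr : 0 < r) :
    0 ≤ gfun b v ν r x := by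
  unfold gfun
  positivity

lemma gfun_cont (b v ν r : ℝ) : Continuous (gfun b v ν r) := by
  unfold gfun
  fun_prop

lemma gfun_cont_r {b v ν x : ℝ} (hv : 0 ≤ v) :
    ContinuousOn (fun r => gfun b v ν r x) (Ioi 0) := by
  unfold gfun
  have h1 : ∀ r ∈ Ioi (0:ℝ), r ^ 2 + v ≠ 0 := by
    intro r hr
    have : 0 < r := hr
    positivity
  have h2 : ∀ r ∈ Ioi (0:ℝ), r ≠ 0 := fun r hr => ne_of_gt hr
  fun_prop (disch := assumption)

lemma gfun_convex {b v ν r : ℝ} (hν : 0 < ν) (hv : 0 ≤ v) (hr : 0 < r) :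
    ConvexOn ℝ univ (gfun b v ν r) := by
  have key : ∀ t : ℝ, ConvexOn ℝ univ (fun x : ℝ => max (t - x) 0) := by
    intro t
    apply ConvexOn.sup
    · refine ⟨convex_univ, ?_⟩
      intro x _ y _ p q _ _ hpq
      simp only [smul_eq_mul]
      have : t = (p + q) * t := by rw [hpq, one_mul]
      nlinarith
    · exact convexOn_const 0 convex_univ
  have := ((key (b - r)).smul (c := ν * v / (r ^ 2 + v)) (by positivity)).add
    ((key (b + v / r)).smul (c := ν * r ^ 2 / (r ^ 2 + v)) (by positivity))
  exact this

lemma gfun_anti {b v ν r : ℝ} (hν : 0 < ν) (hv : 0 ≤ v) (hr : 0 < r) :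
    Antitone (gfun b v ν r) := by
  intro x y hxy
  unfold gfun
  have h1 : max (b - r - y) 0 ≤ max (b - r - x) 0 := max_le_max (by linarith) le_rfl
  have h2 : max (b + v / r - y) 0 ≤ max (b + v / r - x) 0 := max_le_max (by linarith) le_rfl
  have h3 : 0 ≤ ν * v / (r ^ 2 + v) := by positivity
  have h4 : 0 ≤ ν * r ^ 2 / (r ^ 2 + v) := by positivity
  gcongr

lemma tri_int {a t : ℝ} (h : a ≤ t) :
    IntegrableOn (fun x => max (t - x) 0) (Ioi a) ∧
    ∫ x in Ioi a, max (t - x) 0 = (t - a) ^ 2 / 2 := by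
  have hz : ∀ x ∈ Ioi t, max (t - x) 0 = 0 := by
    intro x hx
    exact max_eq_right (by have : t < x := hx; linarith)
  have h1 : IntegrableOn (fun x => max (t - x) 0) (Ioc a t) := by
    apply (Continuous.integrableOn_Icc (a := a) (b := t) (by fun_prop)).mono_set Ioc_subset_Icc_self
  have h2 : IntegrableOn (fun x => max (t - x) 0) (Ioi t) := by
    rw [integrableOn_congr_fun hz measurableSet_Ioi]
    exact integrableOn_zero
  rw [← Ioc_union_Ioi_eq_Ioi h]
  refine ⟨h1.union h2, ?_⟩
  rw [setIntegral_union (Ioc_disjoint_Ioi le_rfl) measurableSet_Ioi h1 h2,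
    setIntegral_congr_fun measurableSet_Ioi hz]
  rw [setIntegral_congr_fun (g := fun x => t - x) measurableSet_Ioc
    (fun x hx => max_eq_left (by linarith [hx.2]))]
  rw [← intervalIntegral.integral_of_le h]
  simp only [integral_zero, add_zero]
  rw [intervalIntegral.integral_sub (by simp) (by simp)]
  simp
  ring

lemma gfun_integrable {a b v ν r : ℝ} (hv : 0 ≤ v) (hr : 0 < r) (hra : r ≤ b - a) :
    IntegrableOn (gfun b v ν r) (Ioi a) := by
  have h1 : 0 ≤ v / r := by positivity
  exact ((tri_int (a := a) (t := b - r) (by linarith)).1.const_mul _).add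
    ((tri_int (a := a) (t := b + v / r) (by linarith)).1.const_mul _)

lemma gfun_integral {a b v ν r : ℝ} (hv : 0 ≤ v) (hr : 0 < r) (hra : r ≤ b - a) :
    ∫ x in Ioi a, gfun b v ν r x = ν * ((b - a) ^ 2 + v) / 2 := by
  have h1 : 0 ≤ v / r := by positivity
  have h2 : r ^ 2 + v ≠ 0 := by positivity
  unfold gfun
  rw [integral_add ((tri_int (a := a) (t := b - r) (by linarith)).1.const_mul _)
    ((tri_int (a := a) (t := b + v / r) (by linarith)).1.const_mul _)]
  rw [integral_const_mul, integral_const_mul, (tri_int (a := a) (t := b - r) (by linarith)).2,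
    (tri_int (a := a) (t := b + v / r) (by linarith)).2]
  field_simp
  ring

lemma gfun_le {b v ν r x : ℝ} (hν : 0 < ν) (hv : 0 ≤ v) (hr : 0 < r) :
    gfun b v ν r x ≤ max (ν * (b - x)) 0 + ν * r := by
  rcases le_total x (b - r) with h | h
  · rw [gfun_left hv hr h]
    have := le_max_left (ν * (b - x)) 0
    have : 0 < ν * r := by positivity
    linarith
  · have := gfun_anti (b := b) hν hv hr h
    rw [gfun_left hv hr le_rfl] at this
    have := le_max_right (ν * (b - x)) 0
    nlinarith

lemma le_gfun {b v ν r x : ℝ} (hν : 0 < ν) (hv : 0 ≤ v) (hr : 0 < r) :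
    max (ν * (b - x)) 0 ≤ gfun b v ν r x := by
  apply max_le _ (gfun_nonneg hν hv hr)
  have h2 : r ^ 2 + v ≠ 0 := by positivity
  have e : ν * (b - x) = ν * v / (r ^ 2 + v) * (b - r - x) + ν * r ^ 2 / (r ^ 2 + v) * (b + v / r - x) := by
    field_simp
    ring
  rw [e]
  unfold gfun
  have h3 : 0 ≤ ν * v / (r ^ 2 + v) := by positivity
  have h4 : 0 ≤ ν * r ^ 2 / (r ^ 2 + v) := by positivity
  gcongr <;> exact le_max_left _ _

/-- continuity of the objective along the family -/
lemma V_cont {a b v ν M : ℝ} (hν : 0 < ν) (hv : 0 ≤ v) (h : ℝ → ℝ)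
    (hm : AEStronglyMeasurable h (volume.restrict (Ioi a))) (hM : ∀ x, |h x| ≤ M) {δ : ℝ} (hδ : 0 < δ)
    (hδm : δ ≤ b - a) :
    ContinuousOn (fun r => ∫ x in Ioi a, h x * gfun b v ν r x) (Icc δ (b - a)) := by
  have hM0 : 0 ≤ M := (abs_nonneg _).trans (hM 0)
  apply continuousOn_of_dominated
    (bound := (Ioc a (b + v / δ)).indicator (fun _ => M * (ν * (b - a) + ν * (b - a))))
  · intro r hr
    exact hm.mul (gfun_cont b v ν r).aestronglyMeasurable
  · intro r hr
    have hr0 : 0 < r := hδ.trans_le hr.1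
    refine (ae_restrict_mem measurableSet_Ioi).mono fun x hx => ?_
    have hx' : a < x := hx
    by_cases hxs : x ∈ Ioc a (b + v / δ)
    · rw [indicator_of_mem hxs, norm_mul, Real.norm_eq_abs, Real.norm_eq_abs,
        abs_of_nonneg (gfun_nonneg hν hv hr0)]
      apply mul_le_mul (hM x) _ (gfun_nonneg hν hv hr0) hM0
      refine (gfun_le hν hv hr0).trans ?_
      apply add_le_add
      · apply max_le
        · apply mul_le_mul_of_nonneg_left _ hν.le; linarith
        · apply mul_nonneg hν.le; linarith
      · exact mul_le_mul_of_nonneg_left hr.2 hν.le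
    · rw [indicator_of_notMem hxs, gfun_right hv hr0]
      · simp
      · have : b + v / δ < x := by
          by_contra hc
          exact hxs ⟨hx', not_lt.1 hc⟩
        have : v / r ≤ v / δ := by gcongr; exact hr.1
        linarith
  · apply IntegrableOn.integrable
    apply (integrable_indicator_iff measurableSet_Ioc).2 _ |>.integrableOn
    exact integrableOn_const (by simp)
  · refine Eventually.of_forall fun x => ?_
    refine continuousOn_const.mul ((gfun_cont_r hv).mono ?_)
    intro r hr
    exact hδ.trans_le hr.1


lemma gfun_PL {a b v ν r : ℝ} (hν : 0 < ν) (hv : 0 ≤ v) (hr : 0 < r) (hra : r ≤ b - a) :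
    PLplus a 2 (gfun b v ν r) := by
  have h1 : 0 ≤ v / r := by positivity
  refine ⟨fun x _ => gfun_nonneg hν hv hr, (gfun_cont b v ν r).continuousOn,
    fun j => if j = 0 then a else if j = 1 then b - r else b + v / r, by simp, ?_, ?_, ?_⟩
  · intro j hj
    interval_cases j
    · simp; linarith
    · simp; linarith
  · intro j hj
    interval_cases j
    · refine ⟨ν * b, -ν, fun x hx => ?_⟩
      simp at hx
      rw [gfun_left hv hr hx.2]; ring
    · refine ⟨ν * r ^ 2 / (r ^ 2 + v) * (b + v / r), -(ν * r ^ 2 / (r ^ 2 + v)), fun x hx => ?_⟩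
      simp at hx
      rw [gfun_mid (by linarith) hx.2]; ring
  · intro x hx
    simp at hx
    exact gfun_right hv hr hx.le

lemma gfun_feasible {a b β η v ν r : ℝ} (hν : 0 < ν) (hv : 0 ≤ v) (hr : 0 < r) (hra : r ≤ b - a)
    (hb : ν * (b - a) = η) (hβ : ν * ((b - a) ^ 2 + v) / 2 = β) :
    Feasible a β η ν (gfun b v ν r) := by
  have h1 : 0 ≤ v / r := by positivity
  have hd : ∃ d, -ν ≤ d ∧ HasDerivWithinAt (gfun b v ν r) d (Ioi a) a := by
    rcases lt_or_eq_of_le hra with h | h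
    · refine ⟨-ν, le_rfl, ?_⟩
      have e : HasDerivWithinAt (fun x => ν * (b - x)) (-ν) (Ioi a) a := by
        have := (((hasDerivAt_id a).const_sub b).const_mul ν).hasDerivWithinAt (s := Ioi a)
        simpa using this
      refine e.congr_of_eventuallyEq ?_ (gfun_left hv hr (by linarith))
      have : Iio (b - r) ∈ 𝓝[>] a := mem_nhdsWithin_of_mem_nhds (Iio_mem_nhds (by linarith))
      filter_upwards [this] with x hx
      exact gfun_left hv hr (le_of_lt hx)
    · refine ⟨-(ν * r ^ 2 / (r ^ 2 + v)), ?_, ?_⟩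
      · rw [neg_le_neg_iff, div_le_iff₀ (by positivity)]
        nlinarith
      have e : HasDerivWithinAt (fun x => ν * r ^ 2 / (r ^ 2 + v) * (b + v / r - x))
          (-(ν * r ^ 2 / (r ^ 2 + v))) (Ioi a) a := by
        have := (((hasDerivAt_id a).const_sub (b + v / r)).const_mul
          (ν * r ^ 2 / (r ^ 2 + v))).hasDerivWithinAt (s := Ioi a)
        simpa using this
      refine e.congr_of_eventuallyEq ?_ (gfun_mid (by linarith) (by linarith))
      have : Iio (b + v / r) ∈ 𝓝[>] a := mem_nhdsWithin_of_mem_nhds (Iio_mem_nhds (by linarith))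
      filter_upwards [this, self_mem_nhdsWithin] with x hx hx2
      have hx2' : a < x := hx2
      exact gfun_mid (by linarith) (le_of_lt hx)
  obtain ⟨d, hd1, hd2⟩ := hd
  refine ⟨gfun_integrable hv hr hra, ?_, ?_, (gfun_cont b v ν r).continuousWithinAt, ⟨d, hd2⟩, ?_,
    (gfun_convex hν hv hr).subset (subset_univ _) (convex_Ici a), fun x _ => gfun_nonneg hν hv hr⟩
  · rw [gfun_integral hv hr hra, hβ]
  · rw [gfun_left hv hr (by linarith), hb]
  · unfold rightDeriv
    rw [hd2.derivWithin (uniqueDiffWithinAt_Ioi a)]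
    exact hd1

lemma feas_cont {a β η ν : ℝ} {f : ℝ → ℝ} (hf : Feasible a β η ν f) : ContinuousOn f (Ici a) := by
  obtain ⟨_, _, _, h1, _, _, h2, _⟩ := hf
  exact h2.continuousOn_Ici h1

lemma feas_ge {a b β η ν : ℝ} {f : ℝ → ℝ} (hb : ν * (b - a) = η)
    (hf : Feasible a β η ν f) {x : ℝ} (hx : a ≤ x) :
    max (ν * (b - x)) 0 ≤ f x := by
  obtain ⟨_, _, h3, h1, ⟨d, hd⟩, h4, h2, h5⟩ := hf
  apply max_le _ (h5 x hx)
  unfold rightDeriv at h4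
  rw [hd.derivWithin (uniqueDiffWithinAt_Ioi a)] at h4
  rcases eq_or_lt_of_le hx with rfl | hx
  · rw [h3, hb]
  have := h2.le_slope_of_hasDerivWithinAt_Ioi (mem_Ici.2 le_rfl) (mem_Ici.2 hx.le) hx hd
  rw [slope_def_field, le_div_iff₀ (by linarith), h3] at this
  nlinarith

lemma conv3 {a : ℝ} {f : ℝ → ℝ} (hf : ConvexOn ℝ (Ici a) f) {x y z : ℝ} (hax : a ≤ x) (hxy : x < y)
    (hyz : y < z) : (z - x) * f y ≤ (z - y) * f x + (y - x) * f z := by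
  have := hf.slope_mono_adjacent (mem_Ici.2 hax) (mem_Ici.2 (hax.trans (hxy.trans hyz).le)) hxy hyz
  rw [div_le_div_iff₀ (by linarith) (by linarith)] at this
  nlinarith

lemma feas_anti {a β η ν : ℝ} {f : ℝ → ℝ} (hf : Feasible a β η ν f) {x y : ℝ} (hx : a ≤ x)
    (hxy : x ≤ y) : f y ≤ f x := by
  obtain ⟨hi, _, h3, h1, _, h4, h2, h5⟩ := hf
  by_contra hc
  push Not at hc
  have hlt : x < y := by
    rcases eq_or_lt_of_le hxy with h | h
    · rw [h] at hc; exact absurd hc (lt_irrefl _)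
    · exact h
  have hfy : 0 < f y := (h5 x hx).trans_lt hc
  have hz : ∀ z ∈ Ioi y, ‖f y‖ ≤ ‖f z‖ := by
    intro z hz
    have hz' : y < z := hz
    rw [Real.norm_eq_abs, Real.norm_eq_abs, abs_of_pos hfy, abs_of_nonneg (h5 z (by linarith))]
    have := conv3 h2 hx hlt hz'
    by_contra hcc
    push Not at hcc
    nlinarith [mul_pos (sub_pos.2 hz') (sub_pos.2 hc), mul_pos (sub_pos.2 hlt) (sub_pos.2 hcc)]
  have h6 : IntegrableOn f (Ioi y) := hi.mono_set (Ioi_subset_Ioi (hx.trans hxy))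
  have h7 : IntegrableOn (fun _ => f y) (Ioi y) :=
    Integrable.mono h6 aestronglyMeasurable_const
      ((ae_restrict_mem measurableSet_Ioi).mono hz)
  rw [integrableOn_const_iff] at h7
  rcases h7 with h7 | h7
  · exact hfy.ne' (by simpa using h7)
  · simp at h7

lemma L_int {a b ν : ℝ} (hν : 0 < ν) (h : a ≤ b) :
    IntegrableOn (fun x => max (ν * (b - x)) 0) (Ioi a) ∧
    ∫ x in Ioi a, max (ν * (b - x)) 0 = ν * (b - a) ^ 2 / 2 := by
  have e : (fun x => max (ν * (b - x)) 0) = fun x => ν * max (b - x) 0 := by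
    funext x
    rw [mul_max_of_nonneg _ _ hν.le, mul_zero]
  rw [e]
  refine ⟨(tri_int h).1.const_mul _, ?_⟩
  rw [integral_const_mul, (tri_int h).2]
  ring

/-- No dip between two points of the second segment. -/
lemma nodip {a b β η ν v r : ℝ} {f : ℝ → ℝ} (hf : Feasible a β η ν f) (hra : r ≤ b - a)
    {x y z : ℝ} (hx : b - r ≤ x) (hxy : x < y) (hyz : y < z) (hz : z ≤ b + v / r)
    (hux : f x ≤ gfun b v ν r x) (huz : f z ≤ gfun b v ν r z) : f y ≤ gfun b v ν r y := by
  obtain ⟨hi, _, h3, h1, _, h4, h2, h5⟩ := hf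
  have := conv3 h2 (by linarith) hxy hyz
  rw [gfun_mid (by linarith) (by linarith)] at hux huz ⊢
  set s := ν * r ^ 2 / (r ^ 2 + v)
  have h6 := mul_le_mul_of_nonneg_left hux (sub_pos.2 hyz).le
  have h7 := mul_le_mul_of_nonneg_left huz (sub_pos.2 hxy).le
  have : (z - x) * f y ≤ (z - x) * (s * (b + v / r - y)) := by
    refine this.trans ((add_le_add h6 h7).trans (le_of_eq ?_))
    ring
  exact le_of_mul_le_mul_left this (by linarith)

/-- Positive part of `g - f` is located in the second segment. -/
lemma pos_loc {a b β η ν v r : ℝ} {f : ℝ → ℝ} (hv : 0 ≤ v) (hr : 0 < r)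
    (hb : ν * (b - a) = η) (hf : Feasible a β η ν f) {x : ℝ} (hx : a ≤ x)
    (hu : f x < gfun b v ν r x) : b - r < x ∧ x < b + v / r := by
  have h := feas_ge hb hf hx
  constructor
  · by_contra hc
    rw [gfun_left hv hr (not_lt.1 hc)] at hu
    linarith [le_max_left (ν * (b - x)) 0]
  · by_contra hc
    rw [gfun_right hv hr (not_lt.1 hc)] at hu
    linarith [le_max_right (ν * (b - x)) 0]

/-- One sided sign-change lemma. -/
lemma sign_lemma {s : Set ℝ} (hs : MeasurableSet s) {h u : ℝ → ℝ} (hpos : ∀ x, 0 ≤ h x)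
    (hbd : ∃ M, ∀ x, |h x| ≤ M)
    (hu : IntegrableOn u s) (hhu : IntegrableOn (fun x => h x * u x) s) (h0 : ∫ x in s, u x = 0)
    (hpat : ∀ x ∈ s, ∀ y ∈ s, u x < 0 → 0 < u y → h x ≤ h y) :
    0 ≤ ∫ x in s, h x * u x := by
  obtain ⟨M, hM⟩ := hbd
  have key : ∃ κ, ∀ x ∈ s, κ * u x ≤ h x * u x := by
    by_cases hne : ∃ y ∈ s, 0 < u y
    · obtain ⟨y0, hy0, hy0'⟩ := hne
      set S := h '' {y | y ∈ s ∧ 0 < u y}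
      have hS : S.Nonempty := ⟨_, y0, ⟨hy0, hy0'⟩, rfl⟩
      have hB : BddBelow S := ⟨0, by rintro _ ⟨y, _, rfl⟩; exact hpos y⟩
      refine ⟨sInf S, fun x hx => ?_⟩
      rcases lt_trichotomy (u x) 0 with hlt | heq | hgt
      · apply mul_le_mul_of_nonpos_right _ hlt.le
        apply le_csInf hS
        rintro _ ⟨y, ⟨hy1, hy2⟩, rfl⟩
        exact hpat x hx y hy1 hlt hy2
      · simp [heq]
      · apply mul_le_mul_of_nonneg_right _ hgt.le
        exact csInf_le hB ⟨x, ⟨hx, hgt⟩, rfl⟩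
    · push Not at hne
      refine ⟨M, fun x hx => ?_⟩
      exact mul_le_mul_of_nonpos_right ((le_abs_self _).trans (hM x)) (hne x hx)
  obtain ⟨κ, hκ⟩ := key
  calc 0 = ∫ x in s, κ * u x := by rw [integral_const_mul, h0, mul_zero]
    _ ≤ _ := setIntegral_mono_on (hu.const_mul κ) hhu hs hκ


lemma hmul_int {s : Set ℝ} {h f : ℝ → ℝ} {M : ℝ} (hM : ∀ x, |h x| ≤ M)
    (hm : AEStronglyMeasurable h (volume.restrict s)) (hf : IntegrableOn f s) :
    IntegrableOn (fun x => h x * f x) s :=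
  Integrable.bdd_mul hf hm (Eventually.of_forall fun x => hM x)

lemma split_int {a c : ℝ} (hac : a ≤ c) {u : ℝ → ℝ} (hu : IntegrableOn u (Ioi a)) :
    ∫ x in Ioi a, u x = (∫ x in Ioo a c, u x) + ∫ x in Ioi c, u x := by
  rw [← integral_Ioc_eq_integral_Ioo, ← Ioc_union_Ioi_eq_Ioi hac,
    setIntegral_union (Ioc_disjoint_Ioi le_rfl) measurableSet_Ioi]
  · exact hu.mono_set Ioc_subset_Ioi_self
  · exact hu.mono_set (Ioi_subset_Ioi hac)

lemma dom_core {a c : ℝ} (hac : a ≤ c) {h f g : ℝ → ℝ} (hpos : ∀ x, 0 ≤ h x)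
    (hbd : ∃ M, ∀ x, |h x| ≤ M) (hm : AEStronglyMeasurable h (volume.restrict (Ioi a)))
    (hmono : MonotoneOn h (Ico a c)) (hanti : AntitoneOn h (Ioi c))
    (hf : IntegrableOn f (Ioi a)) (hg : IntegrableOn g (Ioi a))
    (h1 : ∫ x in Ioo a c, (g x - f x) = 0) (h2 : ∫ x in Ioi c, (g x - f x) = 0)
    (hL : ∀ x y, a < x → x < y → y < c → f x < g x → f y ≤ g y)
    (hR : ∀ x y, c < x → x < y → f y < g y → f x ≤ g x) :
    ∫ x in Ioi a, h x * f x ≤ ∫ x in Ioi a, h x * g x := by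
  obtain ⟨M, hM⟩ := hbd
  have hu : IntegrableOn (fun x => g x - f x) (Ioi a) := hg.sub hf
  have hhu := hmul_int hM hm hu
  have e : (∫ x in Ioi a, h x * g x) - ∫ x in Ioi a, h x * f x =
      ∫ x in Ioi a, h x * (g x - f x) := by
    rw [← integral_sub (hmul_int hM hm hg) (hmul_int hM hm hf)]
    simp only [mul_sub]
  have s1 : Ioo a c ⊆ Ioi a := Ioo_subset_Ioi_self
  have s2 : Ioi c ⊆ Ioi a := Ioi_subset_Ioi hac
  rw [split_int hac hhu] at e
  have i1 : 0 ≤ ∫ x in Ioo a c, h x * (g x - f x) := by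
    apply sign_lemma measurableSet_Ioo hpos ⟨M, hM⟩ (hu.mono_set s1) (hhu.mono_set s1) h1
    intro x hx y hy hux huy
    rcases lt_trichotomy x y with hlt | heq | hgt
    · exact hmono ⟨hx.1.le, hx.2⟩ ⟨hy.1.le, hy.2⟩ hlt.le
    · rw [heq]
    · linarith [hL y x hy.1 hgt hx.2 (by linarith)]
  have i2 : 0 ≤ ∫ x in Ioi c, h x * (g x - f x) := by
    apply sign_lemma measurableSet_Ioi hpos ⟨M, hM⟩ (hu.mono_set s2) (hhu.mono_set s2) h2
    intro x hx y hy hux huy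
    rcases lt_trichotomy x y with hlt | heq | hgt
    · linarith [hR x y hx hlt (by linarith)]
    · rw [heq]
    · exact hanti hy hx hgt.le
  linarith

/-- nonpositive with zero integral on an open set containing an interval: there is a zero. -/
lemma exists_zero {s : Set ℝ} (hs : MeasurableSet s) {u : ℝ → ℝ} (hu : IntegrableOn u s)
    (hle : ∀ x ∈ s, u x ≤ 0) (h0 : ∫ x in s, u x = 0) {p q : ℝ} (hpq : p < q) (hsub : Ioo p q ⊆ s) :
    ∃ z ∈ Ioo p q, u z = 0 := by
  have h1 : ∫ x in s, (-u x) = 0 := by rw [integral_neg, h0, neg_zero]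
  have hni : IntegrableOn (fun x => -u x) s volume := hu.neg
  rw [setIntegral_eq_zero_iff_of_nonneg_ae
    ((ae_restrict_mem hs).mono fun x hx => by simpa using hle x hx) hni] at h1
  have h2 := ae_restrict_of_ae_restrict_of_subset hsub h1
  have : (volume.restrict (Ioo p q)) ≠ 0 := by
    rw [Ne, Measure.restrict_eq_zero, Real.volume_Ioo]
    simp [hpq]
  have : (ae (volume.restrict (Ioo p q))).NeBot := ae_neBot.2 this
  obtain ⟨z, hz, hz2⟩ := (h2.and (ae_restrict_mem measurableSet_Ioo)).exists
  exact ⟨z, hz2, by simpa using hz⟩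

/-- Once `g - f` goes from positive to negative it stays nonpositive. -/
lemma pat_right {a b β η ν v r : ℝ} {f : ℝ → ℝ} (hv : 0 ≤ v) (hr : 0 < r) (hra : r ≤ b - a)
    (hb : ν * (b - a) = η) (hf : Feasible a β η ν f) {x y z : ℝ} (hx : a ≤ x) (hxy : x < y)
    (hyz : y < z) (hux : f x < gfun b v ν r x) (huy : gfun b v ν r y < f y) :
    f z ≥ gfun b v ν r z := by
  by_contra hc
  push Not at hc
  have h1 := pos_loc hv hr hb hf hx hux
  have h2 := pos_loc hv hr hb hf (by linarith) hc
  linarith [nodip hf hra h1.1.le hxy hyz h2.2.le hux.le hc.le]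

/-- the matched case -/
lemma dom_match {a b β η ν v r c : ℝ} (hac : a < c) {h f : ℝ → ℝ} (hpos : ∀ x, 0 ≤ h x)
    (hbd : ∃ M, ∀ x, |h x| ≤ M) (hm : AEStronglyMeasurable h (volume.restrict (Ioi a)))
    (hmono : MonotoneOn h (Ico a c)) (hanti : AntitoneOn h (Ioi c))
    (hν : 0 < ν) (hv : 0 ≤ v) (hr : 0 < r) (hra : r ≤ b - a)
    (hb : ν * (b - a) = η) (hβ : ν * ((b - a) ^ 2 + v) / 2 = β) (hf : Feasible a β η ν f)
    (hi : ∫ x in Ioi c, f x ≠ 0)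
    (hii : ∫ x in Ioo a c, (f x - max (ν * (b - x)) 0) ≠ 0)
    (h2 : ∫ x in Ioi c, (gfun b v ν r x - f x) = 0) :
    ∫ x in Ioi a, h x * f x ≤ ∫ x in Ioi a, h x * gfun b v ν r x := by
  have hvr : 0 ≤ v / r := by positivity
  have hgf := gfun_feasible hν hv hr hra hb hβ
  have hu : IntegrableOn (fun x => gfun b v ν r x - f x) (Ioi a) := hgf.1.sub hf.1
  have h1 : ∫ x in Ioo a c, (gfun b v ν r x - f x) = 0 := by
    have := split_int hac.le hu
    rw [integral_sub hgf.1 hf.1, hgf.2.1, hf.2.1, h2] at this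
    linarith
  have s1 : Ioo a c ⊆ Ioi a := Ioo_subset_Ioi_self
  have s2 : Ioi c ⊆ Ioi a := Ioi_subset_Ioi hac.le
  refine dom_core hac.le hpos hbd hm hmono hanti hf.1 hgf.1 h1 h2 ?_ ?_
  · intro x y hax hxy hyc hux
    by_contra hc
    push Not at hc
    have hle : ∀ z ∈ Ioi c, gfun b v ν r z - f z ≤ 0 := by
      intro z hz
      have := pat_right hv hr hra hb hf hax.le hxy (hyc.trans hz) hux hc
      linarith
    have hlx := pos_loc hv hr hb hf hax.le hux
    rcases lt_or_ge c (b + v / r) with hcT | hcT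
    · obtain ⟨z, hz, hz0⟩ := exists_zero measurableSet_Ioi (hu.mono_set s2) hle h2 hcT
        Ioo_subset_Ioi_self
      have := nodip hf hra hlx.1.le hxy (hyc.trans hz.1) hz.2.le hux.le (by linarith)
      linarith
    · apply hi
      have : ∫ x in Ioi c, (gfun b v ν r x - f x) = ∫ x in Ioi c, - f x := by
        apply setIntegral_congr_fun measurableSet_Ioi
        intro z hz
        have hz' : c < z := hz
        simp only
        rw [gfun_right hv hr (by linarith)]
        ring
      rw [this, integral_neg] at h2
      linarith
  · intro x y hcx hxy huy
    by_contra hc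
    push Not at hc
    have hle : ∀ z ∈ Ioo a c, gfun b v ν r z - f z ≤ 0 := by
      intro z hz
      by_contra hzz
      push Not at hzz
      have := pat_right hv hr hra hb hf hz.1.le (hz.2.trans hcx) hxy (by linarith) hc
      linarith
    have hly := pos_loc hv hr hb hf (by linarith) huy
    rcases lt_or_ge (b - r) c with hcT | hcT
    · have hlt : max a (b - r) < c := max_lt hac hcT
      obtain ⟨z, hz, hz0⟩ := exists_zero measurableSet_Ioo (hu.mono_set s1) hle h1 hlt
        (Ioo_subset_Ioo_left (le_max_left _ _))
      have := nodip hf hra ((le_max_right _ _).trans hz.1.le) (hz.2.trans hcx) hxy hly.2.le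
        (by linarith) huy.le
      linarith
    · apply hii
      rw [← neg_eq_zero, ← integral_neg]
      refine Eq.trans ?_ h1
      apply setIntegral_congr_fun measurableSet_Ioo
      intro z hz
      simp only
      rw [gfun_left hv hr (by linarith [hz.2]), max_eq_left]
      · ring
      · apply mul_nonneg hν.le; linarith [hz.2]

/-- special case (ii): `f` coincides with the extreme line up to `c`. -/
lemma dom_line {a b β η ν v c : ℝ} (hac : a ≤ c) {h f : ℝ → ℝ} (hpos : ∀ x, 0 ≤ h x)
    (hbd : ∃ M, ∀ x, |h x| ≤ M) (hm : AEStronglyMeasurable h (volume.restrict (Ioi a)))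
    (hmono : MonotoneOn h (Ico a c)) (hanti : AntitoneOn h (Ioi c))
    (hν : 0 < ν) (hv : 0 < v) (hη : 0 < η)
    (hb : ν * (b - a) = η) (hβ : ν * ((b - a) ^ 2 + v) / 2 = β) (hf : Feasible a β η ν f)
    (hii : ∫ x in Ioo a c, (f x - max (ν * (b - x)) 0) = 0) :
    ∃ r, 0 < r ∧ r ≤ b - a ∧ ∫ x in Ioi a, h x * f x ≤ ∫ x in Ioi a, h x * gfun b v ν r x := by
  have hab : 0 < b - a := by
    by_contra hc
    nlinarith
  have hL := L_int hν (show a ≤ b by linarith)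
  have heq : ∀ x ∈ Icc a c, f x = max (ν * (b - x)) 0 := by
    rcases eq_or_lt_of_le hac with rfl | hlt
    · intro x hx
      have : x = a := le_antisymm hx.2 hx.1
      rw [this, hf.2.2.1, hb, max_eq_left hη.le]
    · rw [← integral_Ioc_eq_integral_Ioo, ← integral_Icc_eq_integral_Ioc,
        setIntegral_eq_zero_iff_of_nonneg_ae] at hii
      · have h3 : f =ᵐ[volume.restrict (Icc a c)] fun x => max (ν * (b - x)) 0 := by
          filter_upwards [hii] with x hx
          simp at hx
          linarith
        exact Measure.eqOn_Icc_of_ae_eq volume hlt.ne h3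
          ((feas_cont hf).mono Icc_subset_Ici_self) (by fun_prop)
      · refine (ae_restrict_mem measurableSet_Icc).mono fun x hx => ?_
        have := feas_ge hb hf hx.1
        simpa using this
      · rw [integrableOn_Icc_iff_integrableOn_Ioc]
        exact (hf.1.sub hL.1).mono_set Ioc_subset_Ioi_self
  have hcb : c < b := by
    by_contra hc
    push Not at hc
    have hfb := heq b ⟨by linarith, hc⟩
    simp at hfb
    have : ∫ x in Ioi a, f x = ∫ x in Ioi a, max (ν * (b - x)) 0 := by
      apply setIntegral_congr_fun measurableSet_Ioi
      intro x hx
      have hx' : a < x := hx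
      rcases le_total x c with h | h
      · exact heq x ⟨hx'.le, h⟩
      · simp only
        rw [max_eq_right (by nlinarith)]
        apply le_antisymm
        · rw [← hfb]
          exact feas_anti hf (by linarith) (by linarith)
        · exact hf.2.2.2.2.2.2.2 x hx'.le
    rw [hf.2.1, hL.2] at this
    nlinarith
  have hr : 0 < b - c := by linarith
  have hra : b - c ≤ b - a := by linarith
  have hvr : 0 ≤ v / (b - c) := by positivity
  refine ⟨b - c, hr, hra, ?_⟩
  have hgf := gfun_feasible hν hv.le hr hra hb hβ
  have hu : IntegrableOn (fun x => gfun b v ν (b - c) x - f x) (Ioi a) := hgf.1.sub hf.1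
  have hgeq : ∀ x ∈ Icc a c, gfun b v ν (b - c) x = f x := by
    intro x hx
    rw [gfun_left hv.le hr (by linarith [hx.2]), heq x hx, max_eq_left]
    apply mul_nonneg hν.le; linarith [hx.2]
  have h1 : ∫ x in Ioo a c, (gfun b v ν (b - c) x - f x) = 0 := by
    rw [setIntegral_congr_fun (g := fun _ => (0:ℝ)) measurableSet_Ioo]
    · simp
    · intro x hx
      simp only
      rw [hgeq x ⟨hx.1.le, hx.2.le⟩, sub_self]
  have h2 : ∫ x in Ioi c, (gfun b v ν (b - c) x - f x) = 0 := by
    have := split_int hac hu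
    rw [integral_sub hgf.1 hf.1, hgf.2.1, hf.2.1, h1] at this
    linarith
  refine dom_core hac hpos hbd hm hmono hanti hf.1 hgf.1 h1 h2 ?_ ?_
  · intro x y hax hxy hyc _
    exact (hgeq y ⟨by linarith, hyc.le⟩).ge
  · intro x y hcx hxy huy
    have hly := pos_loc hv.le hr hb hf (by linarith) huy
    exact nodip hf hra (by linarith) hcx hxy hly.2.le (hgeq c ⟨hac, le_rfl⟩).ge huy.le

/-- special case (i): `f` vanishes after `c`. -/
lemma dom_vanish {a b β η ν v c : ℝ} (hac : a < c) {h f : ℝ → ℝ} (hpos : ∀ x, 0 ≤ h x)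
    (hbd : ∃ M, ∀ x, |h x| ≤ M) (hm : AEStronglyMeasurable h (volume.restrict (Ioi a)))
    (hmono : MonotoneOn h (Ico a c)) (hanti : AntitoneOn h (Ioi c))
    (hν : 0 < ν) (hv : 0 < v) (hη : 0 < η)
    (hb : ν * (b - a) = η) (hβ : ν * ((b - a) ^ 2 + v) / 2 = β) (hf : Feasible a β η ν f)
    (hi : ∫ x in Ioi c, f x = 0) :
    ∃ r, 0 < r ∧ r ≤ b - a ∧ ∫ x in Ioi a, h x * f x ≤ ∫ x in Ioi a, h x * gfun b v ν r x := by
  have hab : 0 < b - a := by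
    by_contra hc
    nlinarith
  have hf0 := hf.2.2.2.2.2.2.2
  have hfz : ∀ x, c ≤ x → f x = 0 := by
    intro x hx
    have h3 := hi
    rw [← integral_Ici_eq_integral_Ioi, setIntegral_eq_zero_iff_of_nonneg_ae] at h3
    · have h4 : f =ᵐ[volume.restrict (Ici c)] fun _ => 0 := h3
      exact Measure.eqOn_of_ae_eq h4 ((feas_cont hf).mono (Ici_subset_Ici.2 hac.le))
        continuousOn_const (by simp) hx
    · refine (ae_restrict_mem measurableSet_Ici).mono fun y hy => ?_
      exact hf0 y (hac.le.trans hy)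
    · rw [integrableOn_Ici_iff_integrableOn_Ioi]
      exact hf.1.mono_set (Ioi_subset_Ioi hac.le)
  have hchord : ∀ x ∈ Ioi a, f x ≤ η / (c - a) * max (c - x) 0 := by
    intro x hx
    have hx' : a < x := hx
    rcases lt_or_ge x c with h | h
    · have := conv3 hf.2.2.2.2.2.2.1 le_rfl hx' h
      rw [hfz c le_rfl, hf.2.2.1] at this
      rw [max_eq_left (by linarith), div_mul_eq_mul_div, le_div_iff₀ (by linarith)]
      linarith
    · rw [hfz x h]
      have : 0 < c - a := by linarith
      positivity
  have hβle : β ≤ η * (c - a) / 2 := by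
    have h3 := setIntegral_mono_on hf.1 ((tri_int hac.le).1.const_mul (η / (c - a)))
      measurableSet_Ioi hchord
    rw [hf.2.1, integral_const_mul, (tri_int hac.le).2] at h3
    have : 0 < c - a := by linarith
    calc β ≤ _ := h3
      _ = _ := by field_simp
  have hcm : (b - a) ^ 2 + v ≤ (b - a) * (c - a) := by
    have : ν * ((b - a) ^ 2 + v) ≤ ν * ((b - a) * (c - a)) := by
      rw [← mul_assoc, hb]; linarith
    exact le_of_mul_le_mul_left this hν
  have hvle : v ≤ (b - a) * (c - b) := by nlinarith
  have hcb : 0 < c - b := by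
    by_contra hc
    nlinarith
  have hr : 0 < v / (c - b) := by positivity
  have hra : v / (c - b) ≤ b - a := by
    rw [div_le_iff₀ hcb]; exact hvle
  have hT : b + v / (v / (c - b)) = c := by
    field_simp
    ring
  refine ⟨v / (c - b), hr, hra, ?_⟩
  generalize v / (c - b) = r at *
  have hgf := gfun_feasible hν hv.le hr hra hb hβ
  have hu : IntegrableOn (fun x => gfun b v ν r x - f x) (Ioi a) := hgf.1.sub hf.1
  have hgz : ∀ x, c ≤ x → gfun b v ν r x = 0 := fun x hx => gfun_right hv.le hr (by linarith)
  have h2 : ∫ x in Ioi c, (gfun b v ν r x - f x) = 0 := by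
    rw [setIntegral_congr_fun (g := fun _ => (0:ℝ)) measurableSet_Ioi]
    · simp
    · intro x hx
      have hx' : c < x := hx
      simp only
      rw [hgz x hx'.le, hfz x hx'.le, sub_self]
  have h1 : ∫ x in Ioo a c, (gfun b v ν r x - f x) = 0 := by
    have := split_int hac.le hu
    rw [integral_sub hgf.1 hf.1, hgf.2.1, hf.2.1, h2] at this
    linarith
  refine dom_core hac.le hpos hbd hm hmono hanti hf.1 hgf.1 h1 h2 ?_ ?_
  · intro x y hax hxy hyc hux
    have hlx := pos_loc hv.le hr hb hf hax.le hux
    exact nodip hf hra hlx.1.le hxy hyc hT.ge hux.le (by rw [hgz c le_rfl, hfz c le_rfl])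
  · intro x y hcx hxy huy
    rw [hgz x hcx.le, hfz x hcx.le]


lemma dom_finite {a b β η ν v c : ℝ} (hac : a ≤ c) {h f : ℝ → ℝ} (hpos : ∀ x, 0 ≤ h x)
    (hbd : ∃ M, ∀ x, |h x| ≤ M) (hm : AEStronglyMeasurable h (volume.restrict (Ioi a)))
    (hmono : MonotoneOn h (Ico a c)) (hanti : AntitoneOn h (Ioi c))
    (hν : 0 < ν) (hv : 0 < v) (hη : 0 < η)
    (hb : ν * (b - a) = η) (hβ : ν * ((b - a) ^ 2 + v) / 2 = β) (hf : Feasible a β η ν f) :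
    ∃ r, 0 < r ∧ r ≤ b - a ∧ ∫ x in Ioi a, h x * f x ≤ ∫ x in Ioi a, h x * gfun b v ν r x := by
  by_cases hii : ∫ x in Ioo a c, (f x - max (ν * (b - x)) 0) = 0
  · exact dom_line hac hpos hbd hm hmono hanti hν hv hη hb hβ hf hii
  have hac' : a < c := by
    rcases eq_or_lt_of_le hac with rfl | h
    · simp at hii
    · exact h
  by_cases hi : ∫ x in Ioi c, f x = 0
  · exact dom_vanish hac' hpos hbd hm hmono hanti hν hv hη hb hβ hf hi
  have hab : 0 < b - a := by
    by_contra hc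
    nlinarith
  have hL := L_int hν (show a ≤ b by linarith)
  have s1 : Ioo a c ⊆ Ioi a := Ioo_subset_Ioi_self
  have s2 : Ioi c ⊆ Ioi a := Ioi_subset_Ioi hac
  have hgf : ∀ r, 0 < r → r ≤ b - a → Feasible a β η ν (gfun b v ν r) :=
    fun r hr hra => gfun_feasible hν hv.le hr hra hb hβ
  have hfs := split_int hac hf.1
  rw [hf.2.1] at hfs
  have hgs : ∀ r, 0 < r → r ≤ b - a →
      β = (∫ x in Ioo a c, gfun b v ν r x) + ∫ x in Ioi c, gfun b v ν r x := by
    intro r hr hra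
    have := split_int hac (hgf r hr hra).1
    rwa [(hgf r hr hra).2.1] at this
  -- small r
  set δ := ∫ x in Ioo a c, (f x - max (ν * (b - x)) 0) with hδ
  have hδ0 : 0 < δ := by
    apply lt_of_le_of_ne _ (Ne.symm hii)
    apply setIntegral_nonneg measurableSet_Ioo
    intro x hx
    have := feas_ge hb hf hx.1.le
    linarith
  obtain ⟨r0, hr0, hr0m, hr0δ⟩ : ∃ r0, 0 < r0 ∧ r0 ≤ b - a ∧ (c - a) * (ν * r0) ≤ δ := by
    have hca : 0 < c - a := by linarith
    refine ⟨min (b - a) (δ / ((c - a) * ν)), lt_min hab (by positivity), min_le_left _ _, ?_⟩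
    have := min_le_right (b - a) (δ / ((c - a) * ν))
    rw [le_div_iff₀ (by positivity)] at this
    linarith
  have hΦ0 : ∫ x in Ioi c, f x ≤ ∫ x in Ioi c, gfun b v ν r0 x := by
    have h3 : ∫ x in Ioo a c, gfun b v ν r0 x ≤
        ∫ x in Ioo a c, (max (ν * (b - x)) 0 + ν * r0) := by
      apply setIntegral_mono_on ((hgf r0 hr0 hr0m).1.mono_set s1) _ measurableSet_Ioo
      · intro x _
        exact gfun_le hν hv.le hr0
      · exact (hL.1.mono_set s1).add (integrableOn_const (by simp))
    rw [integral_add (hL.1.mono_set s1) (integrableOn_const (by simp))] at h3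
    rw [integral_sub (hf.1.mono_set s1) (hL.1.mono_set s1)] at hδ
    have h4 : ∫ x in Ioo a c, (ν * r0) = (c - a) * (ν * r0) := by
      simp [hac]
    have := hgs r0 hr0 hr0m
    linarith
  have hΦ1 : ∫ x in Ioi c, gfun b v ν (b - a) x ≤ ∫ x in Ioi c, f x := by
    have hg := hgf (b - a) hab le_rfl
    by_cases hex : ∃ y ∈ Ioo a c, gfun b v ν (b - a) y < f y
    · obtain ⟨y, hy, hyu⟩ := hex
      apply setIntegral_mono_on (hg.1.mono_set s2) (hf.1.mono_set s2) measurableSet_Ioi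
      intro z hz
      by_contra hc
      push Not at hc
      have hz' : c < z := hz
      have hlz := pos_loc hv.le hab hb hf (by linarith) hc
      have := nodip (v := v) hf le_rfl (show b - (b - a) ≤ a by linarith) hy.1 (hy.2.trans hz') hlz.2.le
        (by rw [hg.2.2.1, hf.2.2.1]) hc.le
      linarith
    · push Not at hex
      have := setIntegral_mono_on (hf.1.mono_set s1) (hg.1.mono_set s1) measurableSet_Ioo hex
      have := hgs (b - a) hab le_rfl
      linarith
  have e : ∀ r, ∫ x in Ioi a, (Ioi c).indicator (fun _ => (1:ℝ)) x * gfun b v ν r x =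
      ∫ x in Ioi c, gfun b v ν r x := by
    intro r
    have : (fun x => (Ioi c).indicator (fun _ => (1:ℝ)) x * gfun b v ν r x) =
        (Ioi c).indicator (gfun b v ν r) := by
      funext x
      by_cases hx : x ∈ Ioi c <;> simp [indicator, hx]
    rw [this, setIntegral_indicator measurableSet_Ioi, inter_eq_self_of_subset_right s2]
  have hcont := V_cont (a := a) (b := b) (v := v) (ν := ν) (M := 1) hν hv.le
    ((Ioi c).indicator (fun _ => (1:ℝ)))
    ((measurable_const.indicator measurableSet_Ioi).aestronglyMeasurable)
    (by intro x; by_cases hx : x ∈ Ioi c <;> simp [indicator, hx]) hr0 hr0m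
  simp only [e] at hcont
  obtain ⟨r, hr, hrF⟩ := intermediate_value_Icc' hr0m hcont ⟨hΦ1, hΦ0⟩
  have hr1 : 0 < r := hr0.trans_le hr.1
  refine ⟨r, hr1, hr.2, dom_match hac' hpos hbd hm hmono hanti hν hv.le hr1 hr.2 hb hβ hf hi hii ?_⟩
  rw [integral_sub ((hgf r hr1 hr.2).1.mono_set s2) (hf.1.mono_set s2)]
  simp only at hrF
  rw [hrF, sub_self]

lemma dom_mono {a b β η ν v : ℝ} {h f : ℝ → ℝ} (hpos : ∀ x, 0 ≤ h x)
    (hbd : ∃ M, ∀ x, |h x| ≤ M) (hm : AEStronglyMeasurable h (volume.restrict (Ioi a)))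
    (hmono : MonotoneOn h (Ici a))
    (hν : 0 < ν) (hv : 0 < v) (hη : 0 < η)
    (hb : ν * (b - a) = η) (hβ : ν * ((b - a) ^ 2 + v) / 2 = β) (hf : Feasible a β η ν f) :
    ∃ r, 0 < r ∧ r ≤ b - a ∧ ∫ x in Ioi a, h x * f x ≤ ∫ x in Ioi a, h x * gfun b v ν r x := by
  by_cases hC : ∃ C, a ≤ C ∧ ∀ x, C ≤ x → h x = h C
  · obtain ⟨C, haC, hC⟩ := hC
    refine dom_finite haC hpos hbd hm (hmono.mono Ico_subset_Ici_self) ?_ hν hv hη hb hβ hf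
    intro x hx y hy _
    rw [hC x (le_of_lt hx), hC y (le_of_lt hy)]
  push Not at hC
  have hstrict : ∀ C, a ≤ C → ∃ x, a ≤ x ∧ h C < h x := by
    intro C haC
    obtain ⟨x, hx, hne⟩ := hC C haC
    exact ⟨x, haC.trans hx, lt_of_le_of_ne (hmono haC (haC.trans hx) hx) (Ne.symm hne)⟩
  have hab : 0 < b - a := by
    by_contra hc
    nlinarith
  have hL := L_int hν (show a ≤ b by linarith)
  obtain ⟨M, hM⟩ := hbd
  set w := fun x => f x - max (ν * (b - x)) 0 with hw
  have hwi : IntegrableOn w (Ioi a) := hf.1.sub hL.1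
  have hw0 : ∀ x, a ≤ x → 0 ≤ w x := fun x hx => sub_nonneg.2 (feas_ge hb hf hx)
  set A := ν * v / 2 with hA
  have hA0 : 0 < A := by positivity
  have hwA : ∫ x in Ioi a, w x = A := by
    rw [hw, integral_sub hf.1 hL.1, hf.2.1, hL.2, ← hβ]
    ring
  have hhw := hmul_int hM hm hwi
  set κ := (∫ x in Ioi a, h x * w x) / A with hκ
  have hκA : ∫ x in Ioi a, h x * w x = κ * A := by rw [hκ]; field_simp
  obtain ⟨C, haC, hCκ⟩ : ∃ C, a ≤ C ∧ κ < h C := by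
    by_contra hcon
    push Not at hcon
    have hlt : ∀ x, a ≤ x → h x < κ := by
      intro x hx
      obtain ⟨y, hy, hxy⟩ := hstrict x hx
      exact hxy.trans_le (hcon y hy)
    have h0 : ∫ x in Ioi a, (κ * w x - h x * w x) = 0 := by
      rw [integral_sub (hwi.const_mul κ) hhw, integral_const_mul, hκA, hwA, sub_self]
    have hki : IntegrableOn (fun x => κ * w x - h x * w x) (Ioi a) volume :=
      (hwi.const_mul κ).sub hhw
    rw [setIntegral_eq_zero_iff_of_nonneg_ae _ hki] at h0
    · have : ∫ x in Ioi a, w x = 0 := by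
        apply integral_eq_zero_of_ae
        filter_upwards [h0, ae_restrict_mem measurableSet_Ioi] with x hx hxa
        have h1 := hlt x (le_of_lt hxa)
        simp only [Pi.zero_apply] at hx ⊢
        have : (κ - h x) * w x = 0 := by linarith
        rcases mul_eq_zero.1 this with h2 | h2
        · linarith
        · exact h2
      linarith
    · refine (ae_restrict_mem measurableSet_Ioi).mono fun x hx => ?_
      have hx' : a < x := hx
      have := mul_nonneg (sub_nonneg.2 (hlt x hx'.le).le) (hw0 x hx'.le)
      simp only [Pi.zero_apply]
      linarith
  have hκ0 : 0 ≤ κ := by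
    apply div_nonneg _ hA0.le
    apply setIntegral_nonneg measurableSet_Ioi
    intro x hx
    exact mul_nonneg (hpos x) (hw0 x (le_of_lt hx))
  have hhC : 0 < h C := hκ0.trans_lt hCκ
  obtain ⟨r, hr, hra, hrs⟩ : ∃ r, 0 < r ∧ r ≤ b - a ∧
      h C * ((C - a) * (ν * r)) ≤ (h C - κ) * A := by
    have h1 : 0 < (h C - κ) * A := mul_pos (by linarith) hA0
    have h2 : 0 < h C * (C - a + 1) * ν := by
      have : 0 < C - a + 1 := by linarith
      positivity
    refine ⟨min (b - a) ((h C - κ) * A / (h C * (C - a + 1) * ν)), lt_min hab (by positivity),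
      min_le_left _ _, ?_⟩
    set r := min (b - a) ((h C - κ) * A / (h C * (C - a + 1) * ν)) with hrdef
    have h3 : 0 < r := lt_min hab (by positivity)
    have h4 : r ≤ (h C - κ) * A / (h C * (C - a + 1) * ν) := min_le_right _ _
    rw [le_div_iff₀ h2] at h4
    have : 0 < h C * ν * r := by positivity
    nlinarith
  refine ⟨r, hr, hra, ?_⟩
  have hgf := gfun_feasible hν hv.le hr hra hb hβ
  set wr := fun x => gfun b v ν r x - max (ν * (b - x)) 0 with hwr
  have hwri : IntegrableOn wr (Ioi a) := hgf.1.sub hL.1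
  have hwr0 : ∀ x, 0 ≤ wr x := fun x => sub_nonneg.2 (le_gfun hν hv.le hr)
  have hwrle : ∀ x, wr x ≤ ν * r := fun x => by
    have := gfun_le (b := b) (x := x) hν hv.le hr
    simp only [hwr]; linarith
  have hwrA : ∫ x in Ioi a, wr x = A := by
    rw [hwr, integral_sub hgf.1 hL.1, hgf.2.1, hL.2, ← hβ]
    ring
  have hhwr := hmul_int hM hm hwri
  have s1 : Ioo a C ⊆ Ioi a := Ioo_subset_Ioi_self
  have s2 : Ioi C ⊆ Ioi a := Ioi_subset_Ioi haC
  have e1 := split_int haC hwri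
  have e2 := split_int haC hhwr
  have i1 : ∫ x in Ioo a C, wr x ≤ (C - a) * (ν * r) := by
    have h4 : ∫ x in Ioo a C, (ν * r) = (C - a) * (ν * r) := by
      simp [haC]
    rw [← h4]
    exact setIntegral_mono_on (hwri.mono_set s1) (integrableOn_const (by simp)) measurableSet_Ioo
      (fun x _ => hwrle x)
  have i2 : 0 ≤ ∫ x in Ioo a C, h x * wr x :=
    setIntegral_nonneg measurableSet_Ioo fun x _ => mul_nonneg (hpos x) (hwr0 x)
  have i3 : h C * ∫ x in Ioi C, wr x ≤ ∫ x in Ioi C, h x * wr x := by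
    rw [← integral_const_mul]
    apply setIntegral_mono_on ((hwri.mono_set s2).const_mul _) (hhwr.mono_set s2) measurableSet_Ioi
    intro x hx
    have hx' : C < x := hx
    exact mul_le_mul_of_nonneg_right (hmono haC (haC.trans hx'.le) hx'.le) (hwr0 x)
  have key : ∫ x in Ioi a, h x * w x ≤ ∫ x in Ioi a, h x * wr x := by
    rw [hκA]
    have : h C * (A - (C - a) * (ν * r)) ≤ h C * ∫ x in Ioi C, wr x :=
      mul_le_mul_of_nonneg_left (by linarith) hhC.le
    nlinarith
  have hhL := hmul_int hM hm hL.1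
  have q1 : ∫ x in Ioi a, h x * w x =
      (∫ x in Ioi a, h x * f x) - ∫ x in Ioi a, h x * max (ν * (b - x)) 0 := by
    rw [← integral_sub (hmul_int hM hm hf.1) hhL]
    simp only [hw, mul_sub]
  have q2 : ∫ x in Ioi a, h x * wr x =
      (∫ x in Ioi a, h x * gfun b v ν r x) - ∫ x in Ioi a, h x * max (ν * (b - x)) 0 := by
    rw [← integral_sub (hmul_int hM hm hgf.1) hhL]
    simp only [hwr, mul_sub]
  linarith


lemma h_meas {a : ℝ} {h : ℝ → ℝ} {c : ℝ} (hac : a ≤ c)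
    (hmono : MonotoneOn h (Ico a c)) (hanti : AntitoneOn h (Ioi c)) :
    AEStronglyMeasurable h (volume.restrict (Ioi a)) := by
  have h1 : AEMeasurable h (volume.restrict (Ioo a c)) :=
    aemeasurable_restrict_of_monotoneOn measurableSet_Ioo (hmono.mono Ioo_subset_Ico_self)
  have h2 : AEMeasurable h (volume.restrict (Ioi c)) :=
    aemeasurable_restrict_of_antitoneOn measurableSet_Ioi hanti
  rw [Measure.restrict_congr_set (Ioo_ae_eq_Ioc (μ := volume))] at h1
  rw [← Ioc_union_Ioi_eq_Ioi hac]
  exact (aemeasurable_union_iff.2 ⟨h1, h2⟩).aestronglyMeasurable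

lemma dom_all {a b β η ν v : ℝ} {h : ℝ → ℝ} (hpos : ∀ x, 0 ≤ h x)
    (hbd : ∃ M, ∀ x, |h x| ≤ M)
    (hquasi : ∃ c : EReal, (a : EReal) ≤ c ∧
      MonotoneOn h {x : ℝ | a ≤ x ∧ (x : EReal) < c} ∧
      AntitoneOn h {x : ℝ | c < (x : EReal)})
    (hν : 0 < ν) (hv : 0 < v) (hη : 0 < η)
    (hb : ν * (b - a) = η) (hβ : ν * ((b - a) ^ 2 + v) / 2 = β) :
    AEStronglyMeasurable h (volume.restrict (Ioi a)) ∧ ∀ f, Feasible a β η ν f →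
    ∃ r, 0 < r ∧ r ≤ b - a ∧ ∫ x in Ioi a, h x * f x ≤ ∫ x in Ioi a, h x * gfun b v ν r x := by
  obtain ⟨c, hac, hmono, hanti⟩ := hquasi
  induction c using EReal.rec with
  | bot => simp at hac
  | coe c =>
    have hac' : a ≤ c := by exact_mod_cast hac
    have h1 : MonotoneOn h (Ico a c) := hmono.mono fun x hx => ⟨hx.1, by exact_mod_cast hx.2⟩
    have h2 : AntitoneOn h (Ioi c) := hanti.mono fun x hx => by
      have hx' : c < x := hx
      exact (by exact_mod_cast hx' : (c : EReal) < x)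
    have hm := h_meas hac' h1 h2
    exact ⟨hm, fun f hf => dom_finite hac' hpos hbd hm h1 h2 hν hv hη hb hβ hf⟩
  | top =>
    have h1 : MonotoneOn h (Ici a) := hmono.mono fun x hx => ⟨hx, EReal.coe_lt_top x⟩
    have hm : AEStronglyMeasurable h (volume.restrict (Ioi a)) :=
      (aemeasurable_restrict_of_monotoneOn measurableSet_Ioi
        (h1.mono Ioi_subset_Ici_self)).aestronglyMeasurable
    exact ⟨hm, fun f hf => dom_mono hpos hbd hm h1 hν hv hη hb hβ hf⟩

lemma seq_exists {V : ℝ → ℝ} {Z m : ℝ} (hm : 0 < m)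
    (H : ∀ δ, 0 < δ → ∀ ε, 0 < ε → ∃ r, 0 < r ∧ r < δ ∧ r ≤ m ∧ Z - ε < V r) :
    ∃ r : ℕ → ℝ, (∀ k, 0 < r k ∧ r k ≤ m ∧ Z - 1 / ((k : ℝ) + 1) < V (r k) ∧
      r k ≤ 1 / ((k : ℝ) + 1)) ∧ Antitone r := by
  have hk : ∀ k : ℕ, 0 < 1 / ((k : ℝ) + 1) := fun k => by positivity
  choose φ hφ using fun (δ : {δ : ℝ // 0 < δ}) (k : ℕ) => H δ.1 δ.2 (1 / ((k : ℝ) + 1)) (hk k)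
  let D : {δ : ℝ // 0 < δ} → ℕ → {δ : ℝ // 0 < δ} := fun δ k =>
    ⟨φ ⟨min δ.1 (1 / ((k : ℝ) + 1)), lt_min δ.2 (hk k)⟩ k, (hφ _ k).1⟩
  let s : ℕ → {δ : ℝ // 0 < δ} := fun n => Nat.rec ⟨1, one_pos⟩ (fun k p => D p k) n
  have hs : ∀ k, s (k + 1) = D (s k) k := fun k => rfl
  refine ⟨fun k => (s (k + 1)).1, fun k => ?_, antitone_nat_of_succ_le fun k => ?_⟩
  · have h1 := hφ ⟨min (s k).1 (1 / ((k : ℝ) + 1)), lt_min (s k).2 (hk k)⟩ k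
    simp only [hs]
    exact ⟨h1.1, h1.2.2.1, h1.2.2.2, h1.2.1.le.trans (min_le_right _ _)⟩
  · have h1 := hφ ⟨min (s (k + 1)).1 (1 / (((k + 1 : ℕ) : ℝ) + 1)),
      lt_min (s (k + 1)).2 (hk (k + 1))⟩ (k + 1)
    change (s (k + 1 + 1)).1 ≤ (s (k + 1)).1
    rw [hs (k + 1)]
    exact h1.2.1.le.trans (min_le_left _ _)

/-- Theorem (optimality structure with a quasi-concave objective): the piecewise linear
class can be taken with at most 2 segments. -/
theorem main_optimality_structure_quasiconcave
    (a β η ν : ℝ) (hβ : 0 < β) (hη : 0 < η) (hν : 0 < ν)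
    (h : ℝ → ℝ) (hbd : ∃ M, ∀ x, |h x| ≤ M) (hpos : ∀ x, 0 ≤ h x)
    (hquasi : ∃ c : EReal, (a : EReal) ≤ c ∧
      MonotoneOn h {x : ℝ | a ≤ x ∧ (x : EReal) < c} ∧
      AntitoneOn h {x : ℝ | c < (x : EReal)})
    (Zstar : ℝ)
    (hZ : Zstar = sSup {z : ℝ | ∃ f : ℝ → ℝ, Feasible a β η ν f ∧
      z = ∫ x in Set.Ioi a, h x * f x})
    (hfeas : ∃ f : ℝ → ℝ, Feasible a β η ν f) :
    (∃ f : ℝ → ℝ, Feasible a β η ν f ∧ PLplus a 2 f ∧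
      (∫ x in Set.Ioi a, h x * f x) = Zstar) ∨
    ((¬ ∃ f : ℝ → ℝ, Feasible a β η ν f ∧ (∫ x in Set.Ioi a, h x * f x) = Zstar) ∧
      ∃ (f : ℕ → ℝ → ℝ) (y₁ y₂ c₂ d₂ : ℕ → ℝ),
        (∀ k, Feasible a β η ν (f k) ∧ PLplus a 2 (f k) ∧
          a ≤ y₁ k ∧ y₁ k ≤ y₂ k ∧
          (∀ x ∈ Set.Icc (y₁ k) (y₂ k), f k x = c₂ k + d₂ k * x) ∧
          (∀ x, y₂ k < x → f k x = 0)) ∧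
        Tendsto (fun k => ∫ x in Set.Ioi a, h x * f k x) atTop (𝓝 Zstar) ∧
        Tendsto y₂ atTop atTop ∧
        Monotone d₂ ∧ (∀ k, d₂ k ≤ 0) ∧ Tendsto d₂ atTop (𝓝 0)) := by
  obtain ⟨M, hM⟩ := hbd
  have hM0 : 0 ≤ M := (abs_nonneg _).trans (hM 0)
  obtain ⟨f0, hf0⟩ := hfeas
  set b := a + η / ν with hbdef
  have hb : ν * (b - a) = η := by rw [hbdef]; field_simp; ring
  have hab : 0 < b - a := by
    rw [hbdef]
    have : 0 < η / ν := by positivity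
    linarith
  obtain ⟨v, hvdef⟩ : ∃ v, v = 2 * β / ν - (b - a) ^ 2 := ⟨_, rfl⟩
  have hβv : ν * ((b - a) ^ 2 + v) / 2 = β := by rw [hvdef]; field_simp; ring
  have hL := L_int hν (show a ≤ b by linarith)
  have hv : 0 ≤ v := by
    have h1 := setIntegral_mono_on hL.1 hf0.1 measurableSet_Ioi
      (fun x hx => feas_ge hb hf0 (le_of_lt hx))
    rw [hL.2, hf0.2.1] at h1
    by_contra hc
    nlinarith
  rcases eq_or_lt_of_le hv with hv0 | hvpos
  · -- degenerate case: only one feasible function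
    left
    have hJ : ∀ f, Feasible a β η ν f → ∫ x in Set.Ioi a, h x * f x =
        ∫ x in Set.Ioi a, h x * max (ν * (b - x)) 0 := by
      intro f hf
      have h0 : ∫ x in Ioi a, (f x - max (ν * (b - x)) 0) = 0 := by
        rw [integral_sub hf.1 hL.1, hf.2.1, hL.2, ← hβv, ← hv0]
        ring
      have hki : IntegrableOn (fun x => f x - max (ν * (b - x)) 0) (Ioi a) volume := hf.1.sub hL.1
      rw [setIntegral_eq_zero_iff_of_nonneg_ae
        ((ae_restrict_mem measurableSet_Ioi).mono fun x hx =>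
          sub_nonneg.2 (feas_ge hb hf (le_of_lt hx))) hki] at h0
      apply integral_congr_ae
      filter_upwards [h0] with x hx
      simp only [Pi.zero_apply] at hx
      rw [sub_eq_zero.1 hx]
    have hgf := gfun_feasible hν hv hab le_rfl hb hβv
    refine ⟨gfun b v ν (b - a), hgf, gfun_PL hν hv hab le_rfl, ?_⟩
    rw [hZ, hJ _ hgf]
    have : {z : ℝ | ∃ f : ℝ → ℝ, Feasible a β η ν f ∧ z = ∫ x in Set.Ioi a, h x * f x} =
        {∫ x in Set.Ioi a, h x * max (ν * (b - x)) 0} := by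
      ext z
      constructor
      · rintro ⟨f, hf, rfl⟩
        exact hJ f hf
      · rintro rfl
        exact ⟨f0, hf0, (hJ f0 hf0).symm⟩
    rw [this, csSup_singleton]
  obtain ⟨hm, P⟩ := dom_all hpos ⟨M, hM⟩ hquasi hν hvpos hη hb hβv
  have hgf : ∀ r, 0 < r → r ≤ b - a → Feasible a β η ν (gfun b v ν r) :=
    fun r hr hra => gfun_feasible hν hv hr hra hb hβv
  have hbdd : BddAbove {z : ℝ | ∃ f : ℝ → ℝ, Feasible a β η ν f ∧
      z = ∫ x in Set.Ioi a, h x * f x} := by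
    refine ⟨M * β, ?_⟩
    rintro _ ⟨f, hf, rfl⟩
    rw [← hf.2.1, ← integral_const_mul]
    apply setIntegral_mono_on (hmul_int hM hm hf.1) (hf.1.const_mul M) measurableSet_Ioi
    intro x hx
    exact mul_le_mul_of_nonneg_right ((le_abs_self _).trans (hM x))
      (hf.2.2.2.2.2.2.2 x (le_of_lt hx))
  have hle : ∀ f, Feasible a β η ν f → ∫ x in Set.Ioi a, h x * f x ≤ Zstar := by
    intro f hf
    rw [hZ]
    exact le_csSup hbdd ⟨f, hf, rfl⟩
  by_cases hatt : ∃ r, 0 < r ∧ r ≤ b - a ∧ ∫ x in Set.Ioi a, h x * gfun b v ν r x = Zstar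
  · left
    obtain ⟨r, hr, hra, hrZ⟩ := hatt
    exact ⟨_, hgf r hr hra, gfun_PL hν hv hr hra, hrZ⟩
  right
  refine ⟨?_, ?_⟩
  · rintro ⟨f, hf, hfZ⟩
    obtain ⟨r, hr, hra, hrf⟩ := P f hf
    exact hatt ⟨r, hr, hra, le_antisymm (hle _ (hgf r hr hra)) (hfZ ▸ hrf)⟩
  have H : ∀ δ, 0 < δ → ∀ ε, 0 < ε → ∃ r, 0 < r ∧ r < δ ∧ r ≤ b - a ∧
      Zstar - ε < ∫ x in Set.Ioi a, h x * gfun b v ν r x := by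
    intro δ hδ ε hε
    have hδ' : 0 < min δ (b - a) := lt_min hδ hab
    obtain ⟨r0, hr0, hr0max⟩ := isCompact_Icc.exists_isMaxOn
      (nonempty_Icc.2 (min_le_right δ (b - a)))
      (V_cont hν hv h hm hM hδ' (min_le_right δ (b - a)))
    have hr0p : 0 < r0 := hδ'.trans_le hr0.1
    have hlt : ∫ x in Set.Ioi a, h x * gfun b v ν r0 x < Zstar :=
      lt_of_le_of_ne (hle _ (hgf r0 hr0p hr0.2)) fun he => hatt ⟨r0, hr0p, hr0.2, he⟩
    have hlt2 : max (Zstar - ε) (∫ x in Set.Ioi a, h x * gfun b v ν r0 x) < Zstar :=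
      max_lt (by linarith) hlt
    have hne : {z : ℝ | ∃ f : ℝ → ℝ, Feasible a β η ν f ∧
      z = ∫ x in Set.Ioi a, h x * f x}.Nonempty := ⟨_, f0, hf0, rfl⟩
    obtain ⟨_, ⟨f, hf, rfl⟩, hfl⟩ := exists_lt_of_lt_csSup hne (hlt2.trans_eq hZ)
    obtain ⟨r, hr, hra, hrf⟩ := P f hf
    refine ⟨r, hr, ?_, hra, ((le_max_left _ _).trans_lt hfl).trans_le hrf⟩
    by_contra hc
    push Not at hc
    have h1 := hr0max (show r ∈ Icc (min δ (b - a)) (b - a) from ⟨(min_le_left _ _).trans hc, hra⟩)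
    have h2 : ∫ x in Set.Ioi a, h x * gfun b v ν r x ≤ ∫ x in Set.Ioi a, h x * gfun b v ν r0 x := h1
    have h3 := ((le_max_right _ _).trans_lt hfl).trans_le hrf
    linarith
  obtain ⟨r, hr, hanti⟩ := seq_exists hab H
  have ht : Tendsto (fun k : ℕ => 1 / ((k : ℝ) + 1)) atTop (𝓝 0) :=
    tendsto_one_div_add_atTop_nhds_zero_nat
  have hr0 : Tendsto r atTop (𝓝 0) :=
    tendsto_of_tendsto_of_tendsto_of_le_of_le tendsto_const_nhds ht (fun k => (hr k).1.le)
      (fun k => (hr k).2.2.2)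
  refine ⟨fun k => gfun b v ν (r k), fun k => b - r k, fun k => b + v / r k,
    fun k => ν * r k ^ 2 / (r k ^ 2 + v) * (b + v / r k), fun k => -(ν * r k ^ 2 / (r k ^ 2 + v)),
    ?_, ?_, ?_, ?_, ?_, ?_⟩
  · intro k
    obtain ⟨h1, h2, h3, h4⟩ := hr k
    have hvr : 0 ≤ v / r k := by positivity
    refine ⟨hgf _ h1 h2, gfun_PL hν hv h1 h2, by linarith, by linarith, ?_, ?_⟩
    · intro x hx
      simp only at hx ⊢
      rw [gfun_mid hx.1 hx.2]
      ring
    · intro x hx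
      exact gfun_right hv h1 hx.le
  · apply tendsto_of_tendsto_of_tendsto_of_le_of_le (g := fun k : ℕ => Zstar - 1 / ((k : ℝ) + 1))
      (h := fun _ => Zstar) _ tendsto_const_nhds (fun k => (hr k).2.2.1.le)
      (fun k => hle _ (hgf _ (hr k).1 (hr k).2.1))
    simpa using ht.const_sub Zstar
  · apply tendsto_atTop_add_const_left
    have h1 : Tendsto r atTop (𝓝[>] 0) :=
      tendsto_nhdsWithin_iff.2 ⟨hr0, Eventually.of_forall fun k => (hr k).1⟩
    simp only [div_eq_mul_inv]
    exact (tendsto_inv_nhdsGT_zero.comp h1).const_mul_atTop hvpos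
  · intro k l hkl
    have h1 := hanti hkl
    have h2 := (hr k).1
    have h3 := (hr l).1
    simp only [neg_le_neg_iff]
    rw [div_le_div_iff₀ (by positivity) (by positivity)]
    have : r l ^ 2 ≤ r k ^ 2 := by gcongr
    nlinarith [mul_le_mul_of_nonneg_left this (mul_nonneg hν.le hv)]
  · intro k
    have := (hr k).1
    simp only [Left.neg_nonpos_iff]
    positivity
  · have h1 : Tendsto (fun k => -(ν * r k ^ 2 / (r k ^ 2 + v))) atTop
        (𝓝 (-(ν * 0 ^ 2 / (0 ^ 2 + v)))) := by
      refine (Tendsto.div ((hr0.pow 2).const_mul ν) ((hr0.pow 2).add_const v) ?_).neg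
      simp [hvpos.ne']
    simpa using h1
end
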